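/- arXiv:1804.10100 — 2 statements merged into one kernel-verified Lean document; each statement's English description precedes it below -/
import Mathlib

section
/- Let ρ_{A^n} be a density matrix on an n-fold tensor product Hilbert space and σ_1, …, σ_n positive definite density matrices. Then D(ρ_{A^n} ‖ σ_1 ⊗ ⋯ ⊗ σ_n) ≤ Σ_{i=1}^n [D(ρ_{A^n} ‖ σ_1 ⊗ ⋯ ⊗ σ_n) − D(ρ_{A^{∼i}} ⊗ σ_i ‖ σ_1 ⊗ ⋯ ⊗ σ_n)], where ρ_{A^{∼i}} is the partial trace of ρ_{A^n} over the i-th factor; equivalently, H(A^n)_ρ ≥ Σ_{i=1}^n H(A_i | A^{∼i})_ρ. -/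
open Matrix BigOperators
open scoped ComplexOrder

noncomputable section

variable {n : Type*} [Fintype n] [DecidableEq n]

/-- Apply a real function to a matrix via its spectral decomposition
(defined to be `0` if the matrix is not Hermitian). -/
noncomputable def matFun (A : Matrix n n ℂ) (f : ℝ → ℝ) : Matrix n n ℂ :=
  if hA : A.IsHermitian then
    (hA.eigenvectorUnitary : Matrix n n ℂ) *
      Matrix.diagonal (fun i => (f (hA.eigenvalues i) : ℂ)) *
      star (hA.eigenvectorUnitary : Matrix n n ℂ)
  else 0

/-- Real power of a (Hermitian) matrix. -/
noncomputable def mpow (A : Matrix n n ℂ) (r : ℝ) : Matrix n n ℂ :=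
  matFun A (fun x => x ^ r)

/-- Logarithm of a (Hermitian) matrix. -/
noncomputable def mlog (A : Matrix n n ℂ) : Matrix n n ℂ :=
  matFun A Real.log

/-- Absolute value `|X| = √(X† X)` of a matrix. -/
noncomputable def mAbs (X : Matrix n n ℂ) : Matrix n n ℂ :=
  mpow (Xᴴ * X) (1/2 : ℝ)

/-- Schatten `p`-(quasi)norm `(tr |X|^p)^{1/p}`. -/
noncomputable def schatten (p : ℝ) (X : Matrix n n ℂ) : ℝ :=
  ((mpow (mAbs X) p).trace.re) ^ (1/p)

/-- `Γ_σ^{1/p}(X) = σ^{1/(2p)} X σ^{1/(2p)}`. -/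
noncomputable def gammaPow (σ : Matrix n n ℂ) (p : ℝ) (X : Matrix n n ℂ) :
    Matrix n n ℂ :=
  mpow σ (1/(2*p)) * X * mpow σ (1/(2*p))

/-- Weighted norm `‖X‖_{p,σ} = ‖Γ_σ^{1/p}(X)‖_p`. -/
noncomputable def wnorm (σ : Matrix n n ℂ) (p : ℝ) (X : Matrix n n ℂ) : ℝ :=
  schatten p (gammaPow σ p X)

/-- The power operator `I_{q,p}(X) = Γ_σ^{-1/q}(|Γ_σ^{1/p}(X)|^{p/q})`. -/
noncomputable def powOp (σ : Matrix n n ℂ) (q p : ℝ) (X : Matrix n n ℂ) :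
    Matrix n n ℂ :=
  mpow σ (-(1/(2*q))) * mpow (mAbs (gammaPow σ p X)) (p/q) * mpow σ (-(1/(2*q)))

/-- Umegaki relative entropy `D(ρ‖σ) = tr(ρ log ρ) - tr(ρ log σ)`. -/
noncomputable def relEnt (ρ σ : Matrix n n ℂ) : ℝ :=
  ((ρ * mlog ρ).trace - (ρ * mlog σ).trace).re

/-- The entropy function `Ent_{p,σ}(X)`. -/
noncomputable def Ent (σ : Matrix n n ℂ) (p : ℝ) (X : Matrix n n ℂ) : ℝ :=
  ((mpow (gammaPow σ p X) p * mlog (mpow (gammaPow σ p X) p)).trace).re -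
    ((mpow (gammaPow σ p X) p * mlog σ).trace).re -
    (wnorm σ p X) ^ p * Real.log ((wnorm σ p X) ^ p)

end

section MatrixLog

open scoped Matrix.Norms.L2Operator MatrixOrder

variable {n : Type*} [Fintype n] [DecidableEq n] {A B : Matrix n n ℂ}

lemma matFun_eq_cfc (hA : A.IsHermitian) (f : ℝ → ℝ) : matFun A f = cfc f A := by
  rw [hA.cfc_eq, matFun, dif_pos hA, Matrix.IsHermitian.cfc, Unitary.conjStarAlgAut_apply]
  rfl

lemma mlog_eq_log (hA : A.IsHermitian) : mlog A = CFC.log A :=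
  matFun_eq_cfc hA Real.log

lemma Commute.mlog_left (hA : A.IsHermitian) (h : Commute A B) : Commute (mlog A) B := by
  rw [mlog_eq_log hA]
  exact Commute.cfc_real h _

lemma mlog_mul_of_commute (hA : A.PosDef) (hB : B.PosDef) (h : Commute A B) :
    mlog (A * B) = mlog A + mlog B := by
  have hcomm : Commute (mlog A) (mlog B) :=
    (((h.mlog_left hA.isHermitian).symm).mlog_left hB.isHermitian).symm
  have hAB : (A * B).IsHermitian := by
    rw [Matrix.IsHermitian, Matrix.conjTranspose_mul, hA.isHermitian.eq, hB.isHermitian.eq, h.eq]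
  rw [mlog_eq_log hA.isHermitian, mlog_eq_log hB.isHermitian] at *
  have hexp : NormedSpace.exp (CFC.log A + CFC.log B) = A * B := by
    rw [Matrix.exp_add_of_commute _ _ hcomm, CFC.exp_log A hA.isStrictlyPositive,
      CFC.exp_log B hB.isStrictlyPositive]
  rw [mlog_eq_log hAB, ← hexp,
    CFC.log_exp _ (IsSelfAdjoint.add IsSelfAdjoint.log IsSelfAdjoint.log)]

lemma mul_mlog_self (hA : A.IsHermitian) :
    A * mlog A = cfc (fun x : ℝ => x * Real.log x) A := by
  have hA' : IsSelfAdjoint A := hA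
  have hf : ContinuousOn Real.log (spectrum ℝ A) :=
    (Matrix.finite_real_spectrum (A := A)).continuousOn _
  rw [cfc_mul (fun x => x) Real.log A continuousOn_id hf, cfc_id' ℝ A, mlog_eq_log hA]
  rfl

lemma continuous_mul_mlog_self :
    Continuous fun x : {M : Matrix n n ℂ // M.IsHermitian} => (x : Matrix n n ℂ) * mlog x.1 := by
  have h : (fun x : {M : Matrix n n ℂ // M.IsHermitian} => (x : Matrix n n ℂ) * mlog x.1) =
      fun x => cfc (fun x : ℝ => x * Real.log x) x.1 := funext fun x => mul_mlog_self x.2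
  rw [h]
  exact Continuous.cfc_of_mem_nhdsSet (𝕜 := ℝ) (p := IsSelfAdjoint) (s := Set.univ)
      (fun x : ℝ => x * Real.log x) Filter.univ_mem continuous_subtype_val
      (fun x => x.2) Real.continuous_mul_log.continuousOn

end MatrixLog

section

variable {n : Type*} [Fintype n] [DecidableEq n] {A B : Matrix n n ℂ}

lemma tendsto_relEnt {ι : Type*} {l : Filter ι} {F : ι → Matrix n n ℂ} (σ : Matrix n n ℂ)
    (hF : Filter.Tendsto F l (nhds A)) (hA : A.IsHermitian) (hFh : ∀ i, (F i).IsHermitian) :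
    Filter.Tendsto (fun i => relEnt (F i) σ) l (nhds (relEnt A σ)) := by
  have hF' : Filter.Tendsto (fun i => (⟨F i, hFh i⟩ : {M : Matrix n n ℂ // M.IsHermitian})) l
      (nhds ⟨A, hA⟩) := tendsto_subtype_rng.2 hF
  have hcont : Continuous fun p : {M : Matrix n n ℂ // M.IsHermitian} => relEnt p.1 σ := by
    have := continuous_mul_mlog_self (n := n)
    unfold relEnt
    fun_prop
  have h := (hcont.tendsto ⟨A, hA⟩).comp hF'
  exact h

end

section

open scoped MatrixOrder

lemma Matrix.PosSemidef.exists_eq_mul_conjTranspose {n : Type*} [Fintype n] [DecidableEq n]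
    {A : Matrix n n ℂ} (hA : A.PosSemidef) : ∃ B : Matrix n n ℂ, A = B * Bᴴ := by
  obtain ⟨B, hB⟩ := CStarAlgebra.nonneg_iff_eq_mul_star_self.1 hA.nonneg
  exact ⟨B, hB⟩

end

section KrausMap

variable {n : Type*} [Fintype n]

/-- The completely positive map with Kraus operators `K`. -/
noncomputable def krausMap {κ : Type*} [Fintype κ] (K : κ → Matrix n n ℂ) (ρ : Matrix n n ℂ) :
    Matrix n n ℂ :=
  ∑ k, K k * ρ * (K k)ᴴ

variable {κ : Type*} [Fintype κ] {K : κ → Matrix n n ℂ}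

lemma posSemidef_krausMap {ρ : Matrix n n ℂ} (hρ : ρ.PosSemidef) : (krausMap K ρ).PosSemidef :=
  Matrix.posSemidef_sum _ fun k _ => hρ.mul_mul_conjTranspose_same (K k)

lemma trace_krausMap_mul (ρ Y : Matrix n n ℂ) :
    (krausMap K ρ * Y).trace = (ρ * ∑ k, (K k)ᴴ * Y * K k).trace := by
  rw [krausMap, Finset.sum_mul, Finset.mul_sum, Matrix.trace_sum, Matrix.trace_sum]
  refine Finset.sum_congr rfl fun k _ => ?_
  rw [Matrix.mul_assoc, Matrix.mul_assoc, Matrix.trace_mul_comm]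
  simp only [Matrix.mul_assoc]

end KrausMap

section DataProcessing

variable {n : Type*} [Fintype n] [DecidableEq n]

/-- The concave quadratic functional `Y ↦ Re (2 tr ρY - tr ωYYᴴ - t tr ρYᴴY)`. Its supremum over `Y`
is, for each `t`, a quasi-entropy of the pair `(ρ, ω)`. -/
noncomputable def quasiQuad (ρ ω : Matrix n n ℂ) (t : ℝ) (Y : Matrix n n ℂ) : ℝ :=
  2 * (ρ * Y).trace.re - (ω * (Y * Yᴴ)).trace.re - t * (ρ * (Yᴴ * Y)).trace.re

lemma re_trace_diagonal_mul_mul_conjTranspose (d : n → ℝ) (M : Matrix n n ℂ) :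
    (Matrix.diagonal (fun i => (d i : ℂ)) * (M * Mᴴ)).trace.re =
      ∑ i, ∑ j, d i * Complex.normSq (M i j) := by
  simp only [Matrix.trace, Matrix.diag, Matrix.diagonal_mul, Matrix.mul_apply (N := Mᴴ),
    Complex.re_sum, Complex.re_ofReal_mul, Finset.mul_sum, Matrix.conjTranspose_apply,
    Complex.star_def, Complex.mul_conj, Complex.ofReal_re]

lemma re_trace_diagonal_conj (U V : Matrix.unitaryGroup n ℂ) (d e : n → ℝ) :
    ((U : Matrix n n ℂ) * Matrix.diagonal (fun i => (d i : ℂ)) * star (U : Matrix n n ℂ) *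
      ((V : Matrix n n ℂ) * Matrix.diagonal (fun i => (e i : ℂ)) * star (V : Matrix n n ℂ))).trace.re =
      ∑ i, ∑ j, Complex.normSq ((star (V : Matrix n n ℂ) * (U : Matrix n n ℂ)) i j) *
        (d j * e i) := by
  set W := star (V : Matrix n n ℂ) * (U : Matrix n n ℂ) with hW
  have h : ((U : Matrix n n ℂ) * Matrix.diagonal (fun i => (d i : ℂ)) * star (U : Matrix n n ℂ) *
      ((V : Matrix n n ℂ) * Matrix.diagonal (fun i => (e i : ℂ)) * star (V : Matrix n n ℂ))).trace =
      (Matrix.diagonal (fun i => (e i : ℂ)) * (W * Matrix.diagonal (fun i => (d i : ℂ)) * Wᴴ)).trace := by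
    rw [← Matrix.star_eq_conjTranspose W, hW, star_mul, star_star, Matrix.trace_mul_comm]
    rw [Matrix.mul_assoc, Matrix.mul_assoc, Matrix.trace_mul_comm]
    simp only [Matrix.mul_assoc]
  rw [h]
  simp only [Matrix.trace, Matrix.diag, Matrix.diagonal_mul, Matrix.mul_apply (N := Wᴴ),
    Complex.re_sum, Matrix.mul_diagonal,
    Finset.mul_sum, Matrix.conjTranspose_apply, Complex.star_def]
  refine Finset.sum_congr rfl fun i _ => Finset.sum_congr rfl fun j _ => ?_
  have : (e i : ℂ) * (W i j * d j * (starRingEnd ℂ) (W i j)) =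
      ((Complex.normSq (W i j) * (d j * e i) : ℝ) : ℂ) := by
    push_cast
    rw [← Complex.mul_conj]
    ring
  rw [this, Complex.ofReal_re]

lemma quasiQuad_unitary (U V : Matrix.unitaryGroup n ℂ) (r s : n → ℝ) (t : ℝ) (y : Matrix n n ℂ) :
    quasiQuad ((U : Matrix n n ℂ) * Matrix.diagonal (fun i => (r i : ℂ)) * star (U : Matrix n n ℂ))
      ((V : Matrix n n ℂ) * Matrix.diagonal (fun i => (s i : ℂ)) * star (V : Matrix n n ℂ)) t
      ((V : Matrix n n ℂ) * y * star (U : Matrix n n ℂ)) =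
    ∑ i, ∑ j, (2 * r j * ((starRingEnd ℂ)
        ((star (V : Matrix n n ℂ) * (U : Matrix n n ℂ)) i j) * y i j).re -
      (s i + t * r j) * Complex.normSq (y i j)) := by
  obtain ⟨U, hU⟩ := U
  obtain ⟨V, hV⟩ := V
  have hUU : star U * U = 1 := (Unitary.mem_iff.1 hU).1
  have hVV : star V * V = 1 := (Unitary.mem_iff.1 hV).1
  have hUU' (M : Matrix n n ℂ) : star U * (U * M) = M := by rw [← Matrix.mul_assoc, hUU, one_mul]
  have hVV' (M : Matrix n n ℂ) : star V * (V * M) = M := by rw [← Matrix.mul_assoc, hVV, one_mul]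
  dsimp only
  have h1 : (U * Matrix.diagonal (fun i => (r i : ℂ)) * star U * (V * y * star U)).trace =
      (Matrix.diagonal (fun i => (r i : ℂ)) * ((star V * U)ᴴ * y)).trace := by
    rw [← Matrix.star_eq_conjTranspose, star_mul, star_star]
    simp only [Matrix.mul_assoc]
    rw [Matrix.trace_mul_comm U]
    simp only [Matrix.mul_assoc, hUU, Matrix.mul_one]
  have h2 : (V * Matrix.diagonal (fun i => (s i : ℂ)) * star V *
      (V * y * star U * (V * y * star U)ᴴ)).trace =
      (Matrix.diagonal (fun i => (s i : ℂ)) * (y * yᴴ)).trace := by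
    simp only [← Matrix.star_eq_conjTranspose, star_mul, star_star]
    simp only [Matrix.mul_assoc, hUU', hVV']
    rw [Matrix.trace_mul_comm V]
    simp only [Matrix.mul_assoc, hVV, Matrix.mul_one]
  have h3 : (U * Matrix.diagonal (fun i => (r i : ℂ)) * star U *
      ((V * y * star U)ᴴ * (V * y * star U))).trace =
      (Matrix.diagonal (fun i => (r i : ℂ)) * (yᴴ * yᴴᴴ)).trace := by
    rw [Matrix.conjTranspose_conjTranspose]
    simp only [← Matrix.star_eq_conjTranspose, star_mul, star_star]
    simp only [Matrix.mul_assoc, hUU', hVV']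
    rw [Matrix.trace_mul_comm U]
    simp only [Matrix.mul_assoc, hUU, Matrix.mul_one]
  have h4 : (Matrix.diagonal (fun i => (r i : ℂ)) * ((star V * U)ᴴ * y)).trace.re =
      ∑ i, ∑ j, r j * ((starRingEnd ℂ) ((star V * U) i j) * y i j).re := by
    rw [Finset.sum_comm]
    simp only [Matrix.trace, Matrix.diag, Matrix.diagonal_mul, Matrix.mul_apply (M := (star V * U)ᴴ),
      Complex.re_sum, Complex.re_ofReal_mul, Finset.mul_sum, Matrix.conjTranspose_apply,
      Complex.star_def]
  rw [quasiQuad, h1, h2, h3, h4, re_trace_diagonal_mul_mul_conjTranspose,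
    re_trace_diagonal_mul_mul_conjTranspose, Finset.sum_comm (s := Finset.univ)
    (f := fun i j => r i * Complex.normSq (yᴴ i j))]
  simp only [Finset.mul_sum, ← Finset.sum_sub_distrib, Matrix.conjTranspose_apply,
    Complex.star_def, Complex.normSq_conj]
  refine Finset.sum_congr rfl fun i _ => Finset.sum_congr rfl fun j _ => ?_
  ring

lemma two_mul_re_sub_normSq_le {r c : ℝ} (hc : 0 < c) (w y : ℂ) :
    2 * r * ((starRingEnd ℂ) w * y).re - c * Complex.normSq y ≤
      Complex.normSq w * (r ^ 2 / c) := by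
  have h := Complex.normSq_nonneg (r * w - c * y)
  rw [← mul_div_assoc, le_div_iff₀ hc]
  simp only [Complex.normSq_apply, Complex.sub_re, Complex.sub_im, Complex.im_ofReal_mul,
    Complex.mul_re, Complex.conj_re, Complex.conj_im, Complex.ofReal_re, Complex.ofReal_im] at h ⊢
  linarith

lemma two_mul_re_sub_normSq_eq {r c : ℝ} (hc : 0 < c) (w : ℂ) :
    2 * r * ((starRingEnd ℂ) w * ((r / c : ℝ) * w)).re - c * Complex.normSq ((r / c : ℝ) * w) =
      Complex.normSq w * (r ^ 2 / c) := by
  simp only [Complex.normSq_apply, Complex.im_ofReal_mul, Complex.mul_re, Complex.conj_re,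
    Complex.conj_im, Complex.ofReal_re, Complex.ofReal_im]
  field_simp
  ring

/-- Spectral description of the relative entropy and of the associated quasi-entropies in terms of
the eigenvalues `r` of `ρ`, `s` of `ω` and the overlaps `w` of their eigenvectors. -/
lemma exists_spectral_relEnt {ρ ω : Matrix n n ℂ} (hρ : ρ.PosSemidef) (hω : ω.PosDef) :
    ∃ (r s : n → ℝ) (w : n → n → ℝ), (∀ j, 0 ≤ r j) ∧ (∀ i, 0 < s i) ∧
      ∑ i, ∑ j, w i j * r j = ρ.trace.re ∧
      relEnt ρ ω = ∑ i, ∑ j, w i j * (r j * Real.log (r j) - r j * Real.log (s i)) ∧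
      ∀ t : ℝ, 0 ≤ t → IsGreatest (Set.range (quasiQuad ρ ω t))
        (∑ i, ∑ j, w i j * (r j ^ 2 / (s i + t * r j))) := by
  set U := hρ.1.eigenvectorUnitary with hU
  set V := hω.1.eigenvectorUnitary with hV
  have hr := hρ.eigenvalues_nonneg
  have hs := hω.eigenvalues_pos
  set r := hρ.1.eigenvalues with hr_def
  set s := hω.1.eigenvalues with hs_def
  have hρs : ρ = (U : Matrix n n ℂ) * Matrix.diagonal (fun i => (r i : ℂ)) *
      star (U : Matrix n n ℂ) := hρ.1.spectral_theorem
  have hωs : ω = (V : Matrix n n ℂ) * Matrix.diagonal (fun i => (s i : ℂ)) *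
      star (V : Matrix n n ℂ) := hω.1.spectral_theorem
  have hone (W : Matrix.unitaryGroup n ℂ) : (1 : Matrix n n ℂ) =
      (W : Matrix n n ℂ) * Matrix.diagonal (fun _ => ((1 : ℝ) : ℂ)) * star (W : Matrix n n ℂ) := by
    simp
  have hlogρ : ρ * mlog ρ = (U : Matrix n n ℂ) *
      Matrix.diagonal (fun i => ((r i * Real.log (r i) : ℝ) : ℂ)) * star (U : Matrix n n ℂ) := by
    have hUU (M : Matrix n n ℂ) : star (U : Matrix n n ℂ) * ((U : Matrix n n ℂ) * M) = M := by
      rw [← Matrix.mul_assoc, Unitary.coe_star_mul_self, one_mul]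
    rw [mlog, matFun, dif_pos hρ.1]
    nth_rewrite 1 [hρs]
    simp only [Matrix.mul_assoc]
    rw [hUU, ← Matrix.mul_assoc (Matrix.diagonal _) (Matrix.diagonal _), Matrix.diagonal_mul_diagonal]
    simp only [← Complex.ofReal_mul]
    rfl
  have hlogω : mlog ω = (V : Matrix n n ℂ) *
      Matrix.diagonal (fun i => ((Real.log (s i) : ℝ) : ℂ)) * star (V : Matrix n n ℂ) := by
    rw [mlog, matFun, dif_pos hω.1]
  refine ⟨r, s, fun i j => Complex.normSq ((star (V : Matrix n n ℂ) * (U : Matrix n n ℂ)) i j),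
    hr, hs, ?_, ?_, fun t ht => ?_⟩
  · have h := re_trace_diagonal_conj U V r (fun _ => 1)
    rw [← hone V, ← hρs, Matrix.mul_one] at h
    simpa using h.symm
  · have h1 := re_trace_diagonal_conj U V (fun j => r j * Real.log (r j)) (fun _ => 1)
    have h2 := re_trace_diagonal_conj U V r (fun i => Real.log (s i))
    rw [← hone V, ← hlogρ, Matrix.mul_one] at h1
    rw [← hlogω, ← hρs] at h2
    rw [relEnt, Complex.sub_re, h1, h2]
    simp only [← Finset.sum_sub_distrib, mul_one, mul_sub]
  · have hc (i j : n) : 0 < s i + t * r j := add_pos_of_pos_of_nonneg (hs i) (mul_nonneg ht (hr j))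
    constructor
    · refine ⟨(V : Matrix n n ℂ) * Matrix.of (fun i j => ((r j / (s i + t * r j) : ℝ) : ℂ) *
        (star (V : Matrix n n ℂ) * (U : Matrix n n ℂ)) i j) * star (U : Matrix n n ℂ), ?_⟩
      rw [hρs, hωs, quasiQuad_unitary]
      exact Finset.sum_congr rfl fun i _ => Finset.sum_congr rfl fun j _ =>
        two_mul_re_sub_normSq_eq (hc i j) _
    · rintro _ ⟨Y, rfl⟩
      have hY : Y = (V : Matrix n n ℂ) * (star (V : Matrix n n ℂ) * Y * (U : Matrix n n ℂ)) *
          star (U : Matrix n n ℂ) := by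
        have hU' : (U : Matrix n n ℂ) * star (U : Matrix n n ℂ) = 1 := Unitary.coe_mul_star_self U
        have hV' : (V : Matrix n n ℂ) * star (V : Matrix n n ℂ) = 1 := Unitary.coe_mul_star_self V
        simp only [Matrix.mul_assoc, hU', Matrix.mul_one]
        rw [← Matrix.mul_assoc, hV', Matrix.one_mul]
      rw [hY, hρs, hωs, quasiQuad_unitary]
      exact Finset.sum_le_sum fun i _ => Finset.sum_le_sum fun j _ =>
        two_mul_re_sub_normSq_le (hc i j) _ _

section Kraus

variable {κ : Type*} [Fintype κ] {K : κ → Matrix n n ℂ}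

lemma trace_krausMap (hK : ∑ k, (K k)ᴴ * K k = 1) (ρ : Matrix n n ℂ) :
    (krausMap K ρ).trace = ρ.trace := by
  simpa [hK] using trace_krausMap_mul (K := K) ρ 1

/-- The Kadison-Schwarz inequality for the adjoint of a trace-preserving completely positive map. -/
lemma trace_kadison_schwarz (hK : ∑ k, (K k)ᴴ * K k = 1) {ρ : Matrix n n ℂ} (hρ : ρ.PosSemidef)
    (Y : Matrix n n ℂ) :
    (ρ * ((∑ k, (K k)ᴴ * Y * K k) * (∑ k, (K k)ᴴ * Y * K k)ᴴ)).trace.re ≤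
      (krausMap K ρ * (Y * Yᴴ)).trace.re := by
  set Z := ∑ k, (K k)ᴴ * Y * K k with hZ
  have hZ' : Zᴴ = ∑ k, (K k)ᴴ * Yᴴ * K k := by
    simp [hZ, Matrix.conjTranspose_sum, Matrix.conjTranspose_mul, Matrix.mul_assoc]
  have hsum : ∑ k, ((K k)ᴴ * Y - Z * (K k)ᴴ) * ((K k)ᴴ * Y - Z * (K k)ᴴ)ᴴ =
      ∑ k, (K k)ᴴ * (Y * Yᴴ) * K k - Z * Zᴴ := by
    have h (k : κ) : ((K k)ᴴ * Y - Z * (K k)ᴴ) * ((K k)ᴴ * Y - Z * (K k)ᴴ)ᴴ =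
        (K k)ᴴ * (Y * Yᴴ) * K k - (K k)ᴴ * Y * K k * Zᴴ - Z * ((K k)ᴴ * Yᴴ * K k) +
          Z * ((K k)ᴴ * K k) * Zᴴ := by
      simp only [Matrix.conjTranspose_sub, Matrix.conjTranspose_mul,
        Matrix.conjTranspose_conjTranspose]
      noncomm_ring
    simp only [h, Finset.sum_add_distrib, Finset.sum_sub_distrib]
    rw [← Finset.sum_mul, ← hZ, ← Finset.mul_sum, ← hZ', ← Finset.sum_mul, ← Finset.mul_sum, hK]
    noncomm_ring
  have hnonneg : 0 ≤ (ρ * ∑ k, ((K k)ᴴ * Y - Z * (K k)ᴴ) * ((K k)ᴴ * Y - Z * (K k)ᴴ)ᴴ).trace := by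
    rw [Finset.mul_sum, Matrix.trace_sum]
    refine Finset.sum_nonneg fun k _ => ?_
    rw [← Matrix.mul_assoc, Matrix.trace_mul_comm, ← Matrix.mul_assoc]
    exact (hρ.conjTranspose_mul_mul_same _).trace_nonneg
  rw [hsum, Matrix.mul_sub, Matrix.trace_sub, ← trace_krausMap_mul] at hnonneg
  have := (Complex.le_def.1 hnonneg).1
  rw [Complex.sub_re, Complex.zero_re] at this
  linarith

lemma quasiQuad_krausMap_le (hK : ∑ k, (K k)ᴴ * K k = 1) {ρ ω : Matrix n n ℂ}
    (hρ : ρ.PosSemidef) (hω : ω.PosSemidef) {t : ℝ} (ht : 0 ≤ t) (Y : Matrix n n ℂ) :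
    quasiQuad (krausMap K ρ) (krausMap K ω) t Y ≤ quasiQuad ρ ω t (∑ k, (K k)ᴴ * Y * K k) := by
  have h1 := trace_kadison_schwarz hK hω Y
  have h2 := trace_kadison_schwarz hK hρ Yᴴ
  have hZ : ∑ k, (K k)ᴴ * Yᴴ * K k = (∑ k, (K k)ᴴ * Y * K k)ᴴ := by
    simp [Matrix.conjTranspose_sum, Matrix.conjTranspose_mul, Matrix.mul_assoc]
  rw [hZ, Matrix.conjTranspose_conjTranspose, Matrix.conjTranspose_conjTranspose] at h2
  rw [quasiQuad, quasiQuad, trace_krausMap_mul ρ Y]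
  have := mul_le_mul_of_nonneg_left h2 ht
  linarith

end Kraus

lemma hasDerivAt_mul_log_add_mul {r s t : ℝ} (hr : 0 ≤ r) (hs : 0 < s) (ht : 0 ≤ t) :
    HasDerivAt (fun t => r * (Real.log (s + t * r) - Real.log s)) (r ^ 2 / (s + t * r)) t := by
  have hc : s + t * r ≠ 0 := by positivity
  have h : HasDerivAt (fun t => s + t * r) r t := by
    simpa using ((hasDerivAt_id t).mul_const r).const_add s
  refine (((h.log hc).sub_const (Real.log s)).const_mul r).congr_deriv ?_
  rw [sq, mul_div_assoc]

lemma tendsto_mul_log_add_mul {r s : ℝ} (hr : 0 ≤ r) :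
    Filter.Tendsto (fun t => r * (Real.log (s + t * r) - Real.log s) - r * Real.log t)
      Filter.atTop (nhds (r * Real.log r - r * Real.log s)) := by
  rcases hr.eq_or_lt with rfl | hr
  · simp
  have h0 : Filter.Tendsto (fun t : ℝ => s / t + r) Filter.atTop (nhds r) := by
    simpa using (tendsto_const_nhds.div_atTop Filter.tendsto_id).add_const r
  have h1 := (((h0.log hr.ne').sub_const (Real.log s)).const_mul r)
  rw [mul_sub] at h1
  refine h1.congr' ?_
  filter_upwards [Filter.eventually_gt_atTop 0, h0.eventually (lt_mem_nhds hr)] with t ht hpos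
  have : s + t * r = t * (s / t + r) := by field_simp
  rw [this, Real.log_mul ht.ne' hpos.ne']
  ring

/-- Relative entropy decreases if all the associated quasi-entropies do. -/
lemma relEnt_le_of_quasiQuad_le {ρ ω ρ' ω' : Matrix n n ℂ} (hρ : ρ.PosSemidef) (hω : ω.PosDef)
    (hρ' : ρ'.PosSemidef) (hω' : ω'.PosDef) (htr : ρ'.trace = ρ.trace)
    (h : ∀ t : ℝ, 0 ≤ t → ∀ Y, ∃ Z, quasiQuad ρ' ω' t Y ≤ quasiQuad ρ ω t Z) :
    relEnt ρ' ω' ≤ relEnt ρ ω := by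
  obtain ⟨r, s, w, hr, hs, htrw, hent, hquad⟩ := exists_spectral_relEnt hρ hω
  obtain ⟨r', s', w', hr', hs', htrw', hent', hquad'⟩ := exists_spectral_relEnt hρ' hω'
  have hlim (r s : n → ℝ) (w : n → n → ℝ) (hr : ∀ j, 0 ≤ r j) :
      Filter.Tendsto (fun t => ∑ i, ∑ j, w i j * (r j * (Real.log (s i + t * r j) - Real.log (s i)))
        - (∑ i, ∑ j, w i j * r j) * Real.log t) Filter.atTop
        (nhds (∑ i, ∑ j, w i j * (r j * Real.log (r j) - r j * Real.log (s i)))) := by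
    simp only [Finset.sum_mul, ← Finset.sum_sub_distrib, mul_assoc, ← mul_sub (w _ _)]
    exact tendsto_finsetSum _ fun i _ => tendsto_finsetSum _ fun j _ =>
      (tendsto_mul_log_add_mul (hr j)).const_mul _
  have hderiv (r s : n → ℝ) (w : n → n → ℝ) (hr : ∀ j, 0 ≤ r j) (hs : ∀ i, 0 < s i) (t : ℝ)
      (ht : 0 ≤ t) :
      HasDerivAt (fun t => ∑ i, ∑ j, w i j * (r j * (Real.log (s i + t * r j) - Real.log (s i))))
        (∑ i, ∑ j, w i j * (r j ^ 2 / (s i + t * r j))) t :=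
    HasDerivAt.fun_sum fun i _ => HasDerivAt.fun_sum fun j _ =>
      (hasDerivAt_mul_log_add_mul (hr j) (hs i) ht).const_mul _
  have hmono : MonotoneOn (fun t =>
      (∑ i, ∑ j, w i j * (r j * (Real.log (s i + t * r j) - Real.log (s i)))) -
      ∑ i, ∑ j, w' i j * (r' j * (Real.log (s' i + t * r' j) - Real.log (s' i)))) (Set.Ici 0) := by
    have hd (t : ℝ) (ht : 0 ≤ t) := (hderiv r s w hr hs t ht).sub (hderiv r' s' w' hr' hs' t ht)
    refine monotoneOn_of_deriv_nonneg (convex_Ici 0)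
      (fun t ht => (hd t ht).continuousAt.continuousWithinAt)
      (fun t ht => (hd t (interior_subset ht)).differentiableAt.differentiableWithinAt)
      fun t ht => ?_
    have ht0 : 0 ≤ t := interior_subset (s := Set.Ici (0 : ℝ)) ht
    refine le_of_le_of_eq ?_ (hd t ht0).deriv.symm
    obtain ⟨Y, hY⟩ := (hquad' t ht0).1
    obtain ⟨Z, hZ⟩ := h t ht0 Y
    rw [sub_nonneg, ← hY]
    exact hZ.trans ((hquad t ht0).2 ⟨Z, rfl⟩)
  rw [hent, hent']
  refine le_of_tendsto_of_tendsto (hlim r' s' w' hr') (hlim r s w hr) ?_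
  filter_upwards [Filter.eventually_ge_atTop 0] with t ht
  have := hmono (Set.mem_Ici.2 le_rfl) ht ht
  rw [htrw, htrw', htr]
  simp only [zero_mul, add_zero, sub_self, mul_zero, Finset.sum_const_zero] at this
  linarith

/-- **Data processing inequality**: relative entropy is monotone under quantum channels. -/
theorem relEnt_krausMap_le {κ : Type*} [Fintype κ] {K : κ → Matrix n n ℂ}
    (hK : ∑ k, (K k)ᴴ * K k = 1) {ρ ω : Matrix n n ℂ} (hρ : ρ.PosSemidef) (hω : ω.PosDef)
    (hKω : (krausMap K ω).PosDef) :
    relEnt (krausMap K ρ) (krausMap K ω) ≤ relEnt ρ ω :=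
  relEnt_le_of_quasiQuad_le hρ hω (posSemidef_krausMap hρ) hKω (trace_krausMap hK ρ)
    fun _ ht _ => ⟨_, quasiQuad_krausMap_le hK hρ hω.posSemidef ht _⟩

end DataProcessing

lemma posDef_krausMap {n κ : Type*} [Fintype n] [DecidableEq n] [Fintype κ]
    {K : κ → Matrix n n ℂ} (hK : (krausMap K 1).PosDef) {ρ : Matrix n n ℂ} (hρ : ρ.PosDef) :
    (krausMap K ρ).PosDef := by
  have hquad (ω : Matrix n n ℂ) (x : n → ℂ) : star x ⬝ᵥ (krausMap K ω *ᵥ x) =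
      ∑ k, star ((K k)ᴴ *ᵥ x) ⬝ᵥ (ω *ᵥ ((K k)ᴴ *ᵥ x)) := by
    rw [krausMap, Matrix.sum_mulVec, dotProduct_sum]
    refine Finset.sum_congr rfl fun k _ => ?_
    rw [Matrix.star_mulVec, Matrix.conjTranspose_conjTranspose, ← Matrix.dotProduct_mulVec,
      Matrix.mulVec_mulVec, Matrix.mulVec_mulVec, Matrix.mul_assoc]
  refine .of_dotProduct_mulVec_pos (posSemidef_krausMap hρ.posSemidef).1 fun x hx => ?_
  have h1 := hK.dotProduct_mulVec_pos hx
  rw [hquad] at h1 ⊢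
  obtain ⟨k, hk⟩ : ∃ k, (K k)ᴴ *ᵥ x ≠ 0 := by
    by_contra! h
    simp [h] at h1
  exact Finset.sum_pos' (fun k _ => hρ.posSemidef.dotProduct_mulVec_nonneg _)
    ⟨k, Finset.mem_univ k, hρ.dotProduct_mulVec_pos hk⟩

section SiteOp

variable {ι : Type*} [DecidableEq ι] {α : ι → Type*}

lemma update_eq_comm {i : ι} {x z : (i : ι) → α i} (h : Function.update x i (z i) = z) :
    Function.update z i (x i) = x := by
  rw [← h]
  simp

section

variable [∀ i, Fintype (α i)]

/-- Trace out the `i`-th tensor factor of `ρ` and put `s` in its place. -/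
noncomputable def replaceSite (i : ι) (s : Matrix (α i) (α i) ℂ)
    (ρ : Matrix ((i : ι) → α i) ((i : ι) → α i) ℂ) :
    Matrix ((i : ι) → α i) ((i : ι) → α i) ℂ :=
  Matrix.of fun x y =>
    (∑ a, ρ (Function.update x i a) (Function.update y i a)) * s (x i) (y i)

lemma replaceSite_comm {i j : ι} (hij : i ≠ j) (s : Matrix (α i) (α i) ℂ)
    (t : Matrix (α j) (α j) ℂ) (ρ : Matrix ((i : ι) → α i) ((i : ι) → α i) ℂ) :
    replaceSite i s (replaceSite j t ρ) = replaceSite j t (replaceSite i s ρ) := by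
  ext x y
  simp only [replaceSite, Matrix.of_apply, Function.update_of_ne hij,
    Function.update_of_ne hij.symm, ← Finset.sum_mul]
  rw [Finset.sum_comm, mul_right_comm]
  simp only [Function.update_comm hij]

lemma continuous_replaceSite (i : ι) (s : Matrix (α i) (α i) ℂ) :
    Continuous (replaceSite i s) := by
  unfold replaceSite
  fun_prop

end

variable [Fintype ι] [∀ i, DecidableEq (α i)]

/-- The operator acting as `B` on the `i`-th tensor factor and as the identity elsewhere. -/
noncomputable def siteOp (i : ι) (B : Matrix (α i) (α i) ℂ) :
    Matrix ((i : ι) → α i) ((i : ι) → α i) ℂ :=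
  Matrix.of fun x y => if Function.update x i (y i) = y then B (x i) (y i) else 0

lemma siteOp_conjTranspose (i : ι) (B : Matrix (α i) (α i) ℂ) :
    siteOp i Bᴴ = (siteOp i B)ᴴ := by
  ext x y
  simp only [siteOp, Matrix.of_apply, Matrix.conjTranspose_apply, apply_ite star, star_zero]
  exact if_congr ⟨update_eq_comm, update_eq_comm⟩ rfl rfl

lemma siteOp_sum {κ : Type*} [Fintype κ] (i : ι) (B : κ → Matrix (α i) (α i) ℂ) :
    siteOp i (∑ k, B k) = ∑ k, siteOp i (B k) := by
  ext x y
  simp only [siteOp, Matrix.of_apply, Matrix.sum_apply]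
  split_ifs <;> simp

variable [∀ i, Fintype (α i)]

lemma sum_ite_update_eq (i : ι) (x : (i : ι) → α i) (f : ((i : ι) → α i) → ℂ) :
    ∑ z, (if Function.update x i (z i) = z then f z else 0) =
      ∑ a, f (Function.update x i a) := by
  rw [← Finset.sum_filter]
  refine Finset.sum_nbij' (fun z => z i) (fun a => Function.update x i a) ?_ ?_ ?_ ?_ ?_
  · simp
  · simp
  · intro z hz
    exact (Finset.mem_filter.1 hz).2
  · simp
  · intro z hz
    rw [(Finset.mem_filter.1 hz).2]

lemma siteOp_mul_apply (i : ι) (B : Matrix (α i) (α i) ℂ)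
    (M : Matrix ((i : ι) → α i) ((i : ι) → α i) ℂ) (x y : (i : ι) → α i) :
    (siteOp i B * M) x y = ∑ a, B (x i) a * M (Function.update x i a) y := by
  have := sum_ite_update_eq i x fun z => B (x i) (z i) * M z y
  simp only [Function.update_self] at this
  rw [← this, Matrix.mul_apply]
  simp only [siteOp, Matrix.of_apply, ite_mul, zero_mul]

lemma mul_siteOp_apply (i : ι) (B : Matrix (α i) (α i) ℂ)
    (M : Matrix ((i : ι) → α i) ((i : ι) → α i) ℂ) (x y : (i : ι) → α i) :
    (M * siteOp i B) x y = ∑ a, M x (Function.update y i a) * B a (y i) := by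
  have := sum_ite_update_eq i y fun z => M x z * B (z i) (y i)
  simp only [Function.update_self] at this
  rw [← this, Matrix.mul_apply]
  refine Finset.sum_congr rfl fun z _ => ?_
  simp only [siteOp, Matrix.of_apply, mul_ite, mul_zero]
  exact if_congr ⟨update_eq_comm, update_eq_comm⟩ rfl rfl

lemma siteOp_one (i : ι) : siteOp i (1 : Matrix (α i) (α i) ℂ) = 1 := by
  ext x y
  rw [← Matrix.mul_one (siteOp i _), siteOp_mul_apply]
  simp only [Matrix.one_apply, ite_mul, one_mul, zero_mul]
  simp

lemma siteOp_mul (i : ι) (B C : Matrix (α i) (α i) ℂ) :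
    siteOp i (B * C) = siteOp i B * siteOp i C := by
  ext x y
  rw [siteOp_mul_apply]
  simp only [siteOp, Matrix.of_apply, Function.update_idem, Function.update_self]
  split_ifs <;> simp [Matrix.mul_apply]

lemma posDef_siteOp (i : ι) {s : Matrix (α i) (α i) ℂ} (hs : s.PosDef) :
    (siteOp i s).PosDef := by
  obtain ⟨B, rfl⟩ := hs.posSemidef.exists_eq_mul_conjTranspose
  refine (Matrix.PosSemidef.posDef_iff_isUnit ?_).2 ?_
  · rw [siteOp_mul, siteOp_conjTranspose]
    exact Matrix.posSemidef_self_mul_conjTranspose _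
  · refine (Matrix.isUnit_iff_isUnit_det _).2 (Matrix.isUnit_det_of_right_inverse
      (B := siteOp i (B * Bᴴ)⁻¹) ?_)
    rw [← siteOp_mul, Matrix.mul_nonsing_inv _ ((Matrix.isUnit_iff_isUnit_det _).1 hs.isUnit),
      siteOp_one]

lemma replaceSite_eq_mul (i : ι) (s : Matrix (α i) (α i) ℂ)
    (ρ : Matrix ((i : ι) → α i) ((i : ι) → α i) ℂ) :
    replaceSite i s ρ = replaceSite i 1 ρ * siteOp i s := by
  ext x y
  rw [mul_siteOp_apply]
  simp [replaceSite, Matrix.one_apply]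

lemma commute_replaceSite_one (i : ι) (ρ : Matrix ((i : ι) → α i) ((i : ι) → α i) ℂ)
    (C : Matrix (α i) (α i) ℂ) : Commute (replaceSite i 1 ρ) (siteOp i C) := by
  ext x y
  rw [← replaceSite_eq_mul, siteOp_mul_apply]
  simp [replaceSite, Matrix.one_apply, mul_comm]

/-- Kraus operators of the map `replaceSite i (B * Bᴴ)`. -/
noncomputable def siteKraus (i : ι) (B : Matrix (α i) (α i) ℂ) (p : α i × α i) :
    Matrix ((i : ι) → α i) ((i : ι) → α i) ℂ :=
  siteOp i (B * Matrix.single p.2 p.1 1)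

lemma krausMap_siteKraus (i : ι) (B : Matrix (α i) (α i) ℂ)
    (ρ : Matrix ((i : ι) → α i) ((i : ι) → α i) ℂ) :
    krausMap (siteKraus i B) ρ = replaceSite i (B * Bᴴ) ρ := by
  ext x y
  simp only [krausMap, siteKraus, ← siteOp_conjTranspose, Matrix.sum_apply, mul_siteOp_apply,
    siteOp_mul_apply, replaceSite, Matrix.of_apply, Fintype.sum_prod_type,
    Matrix.conjTranspose_apply]
  simp only [Matrix.mul_apply, Matrix.single_apply, Finset.sum_mul_sum]
  simp only [ite_and, mul_ite, mul_one, mul_zero, Finset.sum_ite_eq, Finset.mem_univ, if_true,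
    ite_mul, zero_mul, apply_ite star, star_zero, Matrix.conjTranspose_apply]
  exact Finset.sum_congr rfl fun a _ => Finset.sum_congr rfl fun b _ => by ring

lemma sum_siteKraus (i : ι) {B : Matrix (α i) (α i) ℂ} (hB : (B * Bᴴ).trace = 1) :
    ∑ p, (siteKraus i B p)ᴴ * siteKraus i B p = 1 := by
  simp only [siteKraus, ← siteOp_conjTranspose, ← siteOp_mul]
  rw [← siteOp_sum, ← siteOp_one]
  congr 1
  rw [Matrix.trace_mul_comm] at hB
  simp only [Matrix.conjTranspose_mul, Matrix.conjTranspose_single, star_one]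
  have (p : α i × α i) : Matrix.single p.1 p.2 1 * Bᴴ * (B * Matrix.single p.2 p.1 1) =
      Matrix.single p.1 p.1 ((Bᴴ * B) p.2 p.2) := by
    rw [Matrix.mul_assoc, ← Matrix.mul_assoc Bᴴ, ← Matrix.mul_assoc,
      Matrix.single_mul_mul_single, one_mul, mul_one]
  simp only [this, Fintype.sum_prod_type]
  ext a b
  rw [Matrix.sum_apply]
  simp only [Matrix.sum_apply, Matrix.single_apply, Matrix.one_apply]
  simp only [ite_and, Finset.sum_ite_irrel, Finset.sum_const_zero, Finset.sum_ite_eq',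
    Finset.mem_univ, if_true]
  exact if_congr Iff.rfl hB rfl

end SiteOp

section ReplaceSite

variable {ι : Type*} [DecidableEq ι] [Fintype ι] {α : ι → Type*} [∀ i, DecidableEq (α i)]
  [∀ i, Fintype (α i)] {i : ι} {s : Matrix (α i) (α i) ℂ}
  {ρ : Matrix ((i : ι) → α i) ((i : ι) → α i) ℂ}

lemma trace_replaceSite (hs : s.PosDef) (hs1 : s.trace = 1) :
    (replaceSite i s ρ).trace = ρ.trace := by
  obtain ⟨B, rfl⟩ := hs.posSemidef.exists_eq_mul_conjTranspose
  rw [← krausMap_siteKraus, trace_krausMap (sum_siteKraus i hs1)]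

lemma posSemidef_replaceSite (hs : s.PosDef) (hρ : ρ.PosSemidef) :
    (replaceSite i s ρ).PosSemidef := by
  obtain ⟨B, rfl⟩ := hs.posSemidef.exists_eq_mul_conjTranspose
  rw [← krausMap_siteKraus]
  exact posSemidef_krausMap hρ

lemma posDef_replaceSite [∀ i, Nonempty (α i)] (hs : s.PosDef) (hρ : ρ.PosDef) :
    (replaceSite i s ρ).PosDef := by
  obtain ⟨B, rfl⟩ := hs.posSemidef.exists_eq_mul_conjTranspose
  rw [← krausMap_siteKraus]
  refine posDef_krausMap ?_ hρ
  have h : replaceSite i (B * Bᴴ) 1 = siteOp i ((Fintype.card (α i) : ℂ) • (B * Bᴴ)) := by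
    ext x y
    have (a : α i) : Function.update x i a = Function.update y i a ↔
        Function.update x i (y i) = y := by
      refine ⟨fun h => ?_, fun h => ?_⟩
      · rw [← Function.update_idem a, h]
        simp
      · rw [← h]
        simp
    simp only [replaceSite, siteOp, Matrix.of_apply, Matrix.one_apply, this]
    split_ifs <;> simp
  rw [krausMap_siteKraus, h]
  exact posDef_siteOp i (hs.smul (by exact_mod_cast Fintype.card_pos))

lemma mlog_replaceSite [∀ i, Nonempty (α i)] (hs : s.PosDef) (hρ : ρ.PosDef) :
    mlog (replaceSite i s ρ) = mlog (replaceSite i 1 ρ) + mlog (siteOp i s) := by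
  rw [replaceSite_eq_mul, mlog_mul_of_commute (posDef_replaceSite .one hρ) (posDef_siteOp i hs)
    (commute_replaceSite_one i ρ s)]

lemma relEnt_sub_relEnt_replaceSite [∀ i, Nonempty (α i)] (hs : s.PosDef) (hs1 : s.trace = 1)
    (hρ : ρ.PosDef) {ω : Matrix ((i : ι) → α i) ((i : ι) → α i) ℂ} (hω : ω.PosDef)
    (hsω : replaceSite i s ω = ω) :
    relEnt ρ ω - relEnt (replaceSite i s ρ) ω = relEnt ρ (replaceSite i s ρ) := by
  set X := mlog (replaceSite i 1 ρ) - mlog (replaceSite i 1 ω)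
  have hX' : mlog (replaceSite i s ρ) - mlog ω = X := by
    conv_lhs => rw [← hsω]
    rw [mlog_replaceSite hs hρ, mlog_replaceSite hs hω, add_sub_add_right_eq_sub]
  have hcomm (C : Matrix (α i) (α i) ℂ) : Commute X (siteOp i C) :=
    ((commute_replaceSite_one i ρ C).mlog_left (posDef_replaceSite .one hρ).1).sub_left
      ((commute_replaceSite_one i ω C).mlog_left (posDef_replaceSite .one hω).1)
  have htr : (replaceSite i s ρ * X).trace = (ρ * X).trace := by
    obtain ⟨B, rfl⟩ := hs.posSemidef.exists_eq_mul_conjTranspose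
    rw [← krausMap_siteKraus, trace_krausMap_mul]
    simp only [Matrix.mul_assoc, (hcomm _).eq, siteKraus]
    simp only [← Matrix.mul_assoc, ← Finset.sum_mul]
    have h1 := sum_siteKraus i hs1
    simp only [siteKraus] at h1
    rw [h1, Matrix.mul_one]
  rw [← hX', Matrix.mul_sub, Matrix.mul_sub, Matrix.trace_sub, Matrix.trace_sub] at htr
  simp only [relEnt, htr]
  simp only [Complex.sub_re]
  ring

lemma relEnt_replaceSite_le [∀ i, Nonempty (α i)] (hs : s.PosDef) (hs1 : s.trace = 1)
    (hρ : ρ.PosSemidef) {ω : Matrix ((i : ι) → α i) ((i : ι) → α i) ℂ} (hω : ω.PosDef) :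
    relEnt (replaceSite i s ρ) (replaceSite i s ω) ≤ relEnt ρ ω := by
  have h := posDef_replaceSite hs hω
  obtain ⟨B, rfl⟩ := hs.posSemidef.exists_eq_mul_conjTranspose
  rw [← krausMap_siteKraus] at h ⊢
  rw [← krausMap_siteKraus]
  exact relEnt_krausMap_le (sum_siteKraus i hs1) hρ hω h

end ReplaceSite

section ProductState

variable {ι : Type*} [Fintype ι] {α : ι → Type*}

/-- The tensor product of the matrices `σ i`. -/
noncomputable def productMatrix (σ : (i : ι) → Matrix (α i) (α i) ℂ) :
    Matrix ((i : ι) → α i) ((i : ι) → α i) ℂ :=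
  Matrix.of fun x y => ∏ i, σ i (x i) (y i)

variable [DecidableEq ι] [∀ i, Fintype (α i)] {σ : (i : ι) → Matrix (α i) (α i) ℂ}

lemma trace_productMatrix (hσ1 : ∀ i, (σ i).trace = 1) : (productMatrix σ).trace = 1 := by
  have h := Finset.prod_univ_sum (fun _ => Finset.univ) fun i a => σ i a a
  rw [Fintype.piFinset_univ] at h
  simp only [Matrix.trace, Matrix.diag] at hσ1
  rw [Matrix.trace]
  simpa [hσ1, productMatrix] using h.symm

lemma replaceSite_productMatrix (hσ1 : ∀ i, (σ i).trace = 1) (i : ι) :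
    replaceSite i (σ i) (productMatrix σ) = productMatrix σ := by
  ext x y
  have (a : α i) : ∏ j, σ j (Function.update x i a j) (Function.update y i a j) =
      σ i a a * ∏ j ∈ Finset.univ.erase i, σ j (x j) (y j) := by
    rw [← Finset.mul_prod_erase _ _ (Finset.mem_univ i)]
    simp only [Function.update_self]
    congr 1
    refine Finset.prod_congr rfl fun j hj => ?_
    rw [Function.update_of_ne (Finset.ne_of_mem_erase hj),
      Function.update_of_ne (Finset.ne_of_mem_erase hj)]
  have h1 := hσ1 i
  simp only [Matrix.trace, Matrix.diag] at h1
  simp only [replaceSite, productMatrix, Matrix.of_apply, this, ← Finset.sum_mul, h1, one_mul]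
  exact Finset.prod_erase_mul _ _ (Finset.mem_univ i)

variable [∀ i, DecidableEq (α i)] [∀ i, Nonempty (α i)]

/-- Replacing every tensor factor of a state in turn ends in the product state. -/
theorem replaceSite_induction (hσ : ∀ i, (σ i).PosDef) (hσ1 : ∀ i, (σ i).trace = 1)
    {R : Finset ι → Matrix ((i : ι) → α i) ((i : ι) → α i) ℂ → Prop}
    {ρ : Matrix ((i : ι) → α i) ((i : ι) → α i) ℂ} (hρ : ρ.PosDef) (hρ1 : ρ.trace = 1)
    (h0 : R ∅ ρ)
    (hstep : ∀ i S τ, i ∉ S → τ.PosDef → R S τ → R (insert i S) (replaceSite i (σ i) τ)) :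
    (productMatrix σ).PosDef ∧ R Finset.univ (productMatrix σ) := by
  have key (S : Finset ι) : ∃ τ : Matrix ((i : ι) → α i) ((i : ι) → α i) ℂ,
      τ.PosDef ∧ τ.trace = 1 ∧ R S τ ∧ ∃ h : ((i : ι) → α i) → ((i : ι) → α i) → ℂ,
        (∀ x y, τ x y = (∏ i ∈ S, σ i (x i) (y i)) * h x y) ∧
        ∀ x y x' y', (∀ i ∉ S, x i = x' i ∧ y i = y' i) → h x y = h x' y' := by
    induction S using Finset.induction_on with
    | empty =>
      refine ⟨ρ, hρ, hρ1, h0, ρ, by simp, fun x y x' y' h => ?_⟩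
      rw [funext fun i => (h i (Finset.notMem_empty i)).1,
        funext fun i => (h i (Finset.notMem_empty i)).2]
    | insert i S hi ih =>
      obtain ⟨τ, hτ, hτ1, hR, h, hτh, hh⟩ := ih
      refine ⟨replaceSite i (σ i) τ, posDef_replaceSite (hσ i) hτ,
        (trace_replaceSite (hσ i) (hσ1 i)).trans hτ1, hstep i S τ hi hτ hR,
        fun x y => ∑ a, h (Function.update x i a) (Function.update y i a), fun x y => ?_,
        fun x y x' y' hxy => ?_⟩
      · have (a : α i) : ∏ j ∈ S, σ j (Function.update x i a j) (Function.update y i a j) =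
            ∏ j ∈ S, σ j (x j) (y j) := by
          refine Finset.prod_congr rfl fun j hj => ?_
          have hji : j ≠ i := ne_of_mem_of_not_mem hj hi
          rw [Function.update_of_ne hji, Function.update_of_ne hji]
        simp only [replaceSite, Matrix.of_apply, hτh, this, ← Finset.mul_sum,
          Finset.prod_insert hi]
        ring
      · refine Finset.sum_congr rfl fun a _ => hh _ _ _ _ fun j hj => ?_
        by_cases hji : j = i
        · subst hji
          simp
        · simpa [Function.update_of_ne hji] using hxy j (by simp [hji, hj])
  obtain ⟨τ, hτ, hτ1, hR, h, hτh, hh⟩ := key Finset.univ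
  obtain ⟨z⟩ : Nonempty ((i : ι) → α i) := inferInstance
  have hτσ : τ = h z z • productMatrix σ := by
    ext x y
    rw [hτh, hh x y z z (by simp), mul_comm]
    rfl
  have hz : h z z = 1 := by
    rw [hτσ, Matrix.trace_smul, trace_productMatrix hσ1] at hτ1
    simpa using hτ1
  rw [hz, one_smul] at hτσ
  exact ⟨hτσ ▸ hτ, hτσ ▸ hR⟩

lemma posDef_productMatrix (hσ : ∀ i, (σ i).PosDef) (hσ1 : ∀ i, (σ i).trace = 1) :
    (productMatrix σ).PosDef := by
  have hcard : 0 < (Fintype.card ((i : ι) → α i) : ℂ) := by exact_mod_cast Fintype.card_pos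
  exact (replaceSite_induction (R := fun _ _ => True) hσ hσ1
    (ρ := (Fintype.card ((i : ι) → α i) : ℂ)⁻¹ • 1) (Matrix.PosDef.one.smul (inv_pos.2 hcard))
    (by rw [Matrix.trace_smul, Matrix.trace_one, smul_eq_mul, inv_mul_cancel₀ hcard.ne'])
    trivial fun _ _ _ _ _ _ => trivial).1

lemma relEnt_productMatrix_le_of_posDef (hσ : ∀ i, (σ i).PosDef) (hσ1 : ∀ i, (σ i).trace = 1)
    {ρ : Matrix ((i : ι) → α i) ((i : ι) → α i) ℂ} (hρ : ρ.PosDef) (hρ1 : ρ.trace = 1) :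
    relEnt ρ (productMatrix σ) ≤ ∑ i, (relEnt ρ (productMatrix σ) -
      relEnt (replaceSite i (σ i) ρ) (productMatrix σ)) := by
  have hω := posDef_productMatrix hσ hσ1
  set ω := productMatrix σ with hωdef
  have hgap (i : ι) {τ : Matrix ((i : ι) → α i) ((i : ι) → α i) ℂ} (hτ : τ.PosDef) :
      relEnt τ ω - relEnt (replaceSite i (σ i) τ) ω = relEnt τ (replaceSite i (σ i) τ) :=
    relEnt_sub_relEnt_replaceSite (hσ i) (hσ1 i) hτ hω (replaceSite_productMatrix hσ1 i)
  have h := (replaceSite_induction (R := fun S τ =>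
    relEnt ρ ω - relEnt τ ω ≤ ∑ i ∈ S, relEnt ρ (replaceSite i (σ i) ρ) ∧
      ∀ i ∉ S, relEnt τ (replaceSite i (σ i) τ) ≤ relEnt ρ (replaceSite i (σ i) ρ))
    hσ hσ1 hρ hρ1 (by simp) ?_).2.1
  · rw [← hωdef] at h
    have h0 : relEnt ω ω = 0 := by simp [relEnt]
    simp only [hgap _ hρ]
    linarith
  · rintro i S τ hi hτ ⟨hle, hmono⟩
    refine ⟨?_, fun j hj => ?_⟩
    · rw [Finset.sum_insert hi]
      have := hgap i hτ
      have := hmono i hi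
      linarith
    · rw [Finset.mem_insert, not_or] at hj
      rw [replaceSite_comm hj.1]
      exact (relEnt_replaceSite_le (hσ i) (hσ1 i) hτ.posSemidef
        (posDef_replaceSite (hσ j) hτ)).trans (hmono j hj.2)

theorem relEnt_productMatrix_le (hσ : ∀ i, (σ i).PosDef) (hσ1 : ∀ i, (σ i).trace = 1)
    {ρ : Matrix ((i : ι) → α i) ((i : ι) → α i) ℂ} (hρ : ρ.PosSemidef) (hρ1 : ρ.trace = 1) :
    relEnt ρ (productMatrix σ) ≤ ∑ i, (relEnt ρ (productMatrix σ) -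
      relEnt (replaceSite i (σ i) ρ) (productMatrix σ)) := by
  have hω := posDef_productMatrix hσ hσ1
  set ω := productMatrix σ with hωdef
  set F : ℝ → Matrix ((i : ι) → α i) ((i : ι) → α i) ℂ :=
    fun t => ((|1 - t| : ℝ) : ℂ) • ρ + ((|t| : ℝ) : ℂ) • ω with hF
  have hF0 : Filter.Tendsto F (nhdsWithin 0 (Set.Ioo 0 1)) (nhds ρ) := by
    have hc : Continuous F := by fun_prop
    have := hc.tendsto 0
    simp only [hF, sub_zero, abs_one, Complex.ofReal_one, one_smul, abs_zero,
      Complex.ofReal_zero, zero_smul, add_zero] at this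
    exact this.mono_left nhdsWithin_le_nhds
  have hFpsd (t : ℝ) : (F t).PosSemidef :=
    (hρ.smul (by exact_mod_cast abs_nonneg _)).add
      (hω.posSemidef.smul (by exact_mod_cast abs_nonneg _))
  have hlim := tendsto_relEnt ω hF0 hρ.1 fun t => (hFpsd t).1
  have hlim' (i : ι) : Filter.Tendsto (fun t => relEnt (replaceSite i (σ i) (F t)) ω)
      (nhdsWithin 0 (Set.Ioo 0 1)) (nhds (relEnt (replaceSite i (σ i) ρ) ω)) := by
    have h := ((continuous_replaceSite i (σ i)).tendsto ρ).comp hF0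
    have h' := tendsto_relEnt ω h (posSemidef_replaceSite (hσ i) hρ).1
      fun t => (posSemidef_replaceSite (hσ i) (hFpsd t)).1
    exact h'
  have : (nhdsWithin (0 : ℝ) (Set.Ioo 0 1)).NeBot :=
    mem_closure_iff_nhdsWithin_neBot.1 (by rw [closure_Ioo zero_ne_one]; simp)
  refine le_of_tendsto_of_tendsto hlim
    (tendsto_finsetSum Finset.univ fun i _ => hlim.sub (hlim' i)) ?_
  filter_upwards [self_mem_nhdsWithin] with t ht
  refine relEnt_productMatrix_le_of_posDef hσ hσ1 ?_ ?_
  · exact (Matrix.PosDef.posSemidef_add (hρ.smul (by exact_mod_cast abs_nonneg _))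
      (hω.smul (by exact_mod_cast abs_pos.2 ht.1.ne')))
  · rw [Matrix.trace_add, Matrix.trace_smul, Matrix.trace_smul, hρ1, trace_productMatrix hσ1,
      abs_of_pos ht.1, abs_of_pos (sub_pos.2 ht.2)]
    simp

end ProductState

/-- Tensorization inequality for relative entropies:
`D(ρ‖σ_1⊗⋯⊗σ_n) ≤ Σ_i [D(ρ‖σ_1⊗⋯⊗σ_n) − D(ρ_{∼i}⊗σ_i‖σ_1⊗⋯⊗σ_n)]`,
where `ρ_{∼i}` is the partial trace of `ρ` over the `i`-th factor. -/
theorem relEnt_tensorization {k : ℕ} {m : Fin k → ℕ}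
    (ρ : Matrix ((i : Fin k) → Fin (m i)) ((i : Fin k) → Fin (m i)) ℂ)
    (hρ : ρ.PosSemidef) (hρ1 : ρ.trace = 1)
    (σ : (i : Fin k) → Matrix (Fin (m i)) (Fin (m i)) ℂ)
    (hσ : ∀ i, (σ i).PosDef) (hσ1 : ∀ i, (σ i).trace = 1)
    (σFull : Matrix ((i : Fin k) → Fin (m i)) ((i : Fin k) → Fin (m i)) ℂ)
    (hσFull : σFull = Matrix.of fun x y => ∏ i, σ i (x i) (y i))
    (T : Fin k → Matrix ((i : Fin k) → Fin (m i)) ((i : Fin k) → Fin (m i)) ℂ)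
    (hT : ∀ i, T i = Matrix.of fun x y =>
      (∑ a, ρ (Function.update x i a) (Function.update y i a)) * σ i (x i) (y i)) :
    relEnt ρ σFull ≤ ∑ i, (relEnt ρ σFull - relEnt (T i) σFull) := by
  have (i : Fin k) : Nonempty (Fin (m i)) := by
    by_contra h
    rw [not_nonempty_iff] at h
    simpa [Matrix.trace] using hσ1 i
  obtain rfl : T = fun i => replaceSite i (σ i) ρ := funext hT
  subst hσFull
  exact relEnt_productMatrix_le hσ hσ1 hρ hρ1
end

section
/- Let L(X) = X − tr(σX)·I be the simple Lindblad generator for a positive definite density matrix σ, and define the Dirichlet form E_{2,L}(X) := ⟨X, L(X)⟩_σ and entropy Ent_{2,σ}. Then the 2-log-Sobolev constant satisfies α_2(L) = (1 − 2 s_min(σ)) / log(1/s_min(σ) − 1), where s_min(σ) is the minimum eigenvalue of σ (for σ = I/2 in dimension 2, interpret the expression as its limit 1/2). -/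
open Matrix BigOperators
open scoped ComplexOrder

namespace LogSobolev

/-- `sinh` lies below its chords through the origin on the positive half-line. -/
lemma mul_sinh_le_mul_sinh {v w : ℝ} (hv : 0 ≤ v) (hvw : v ≤ w) :
    w * Real.sinh v ≤ v * Real.sinh w := by
  have hconv : ConvexOn ℝ (Set.Ici (0 : ℝ)) Real.sinh := by
    apply MonotoneOn.convexOn_of_deriv (convex_Ici 0) Real.continuous_sinh.continuousOn
      Real.differentiable_sinh.differentiableOn
    intro x hx y hy hxy
    rw [interior_Ici] at hx hy
    simp only [Real.deriv_sinh]
    rw [Real.cosh_le_cosh, abs_of_pos hx, abs_of_pos hy]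
    exact hxy
  rcases eq_or_lt_of_le (hv.trans hvw) with h | hw
  · have : v = 0 := by linarith
    simp [this, ← h]
  · have h := hconv.2 (Set.mem_Ici.2 hw.le) (Set.mem_Ici.2 le_rfl)
      (div_nonneg hv hw.le) (sub_nonneg.2 ((div_le_one hw).2 hvw)) (by ring)
    simp only [smul_eq_mul, mul_zero, add_zero, Real.sinh_zero, div_mul_cancel₀ v hw.ne'] at h
    calc w * Real.sinh v ≤ w * (v / w * Real.sinh w) := by gcongr
      _ = v * Real.sinh w := by field_simp

lemma hasDerivAt_profile (β v : ℝ) :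
    HasDerivAt (fun v => v * (Real.sinh v / Real.cosh v) - Real.log (Real.cosh v)
      + β / Real.cosh v) ((v - β * Real.sinh v) / Real.cosh v ^ 2) v := by
  have hc := (Real.cosh_pos v).ne'
  have h := (((hasDerivAt_id v).mul ((Real.hasDerivAt_sinh v).div (Real.hasDerivAt_cosh v) hc)).sub
    ((Real.hasDerivAt_cosh v).log hc)).add ((hasDerivAt_const v β).div (Real.hasDerivAt_cosh v) hc)
  refine h.congr_deriv ?_
  have := Real.cosh_sq v
  simp only [id, Pi.div_apply]
  field_simp
  linear_combination v * this

/-- If `v - β sinh v` changes sign exactly at `w`, then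
`v tanh v - log cosh v + β / cosh v` is maximal at `w`. -/
lemma profile_le {β v w : ℝ} (hv : 0 ≤ v)
    (h1 : ∀ x, 0 ≤ x → x ≤ w → β * Real.sinh x ≤ x) (h2 : ∀ x, w ≤ x → x ≤ β * Real.sinh x) :
    v * (Real.sinh v / Real.cosh v) - Real.log (Real.cosh v) + β / Real.cosh v ≤
      w * (Real.sinh w / Real.cosh w) - Real.log (Real.cosh w) + β / Real.cosh w := by
  have hcont : Continuous fun v => v * (Real.sinh v / Real.cosh v) - Real.log (Real.cosh v)
      + β / Real.cosh v :=
    continuous_iff_continuousAt.2 fun x => (hasDerivAt_profile β x).continuousAt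
  rcases le_total v w with h | h
  · have hm := monotoneOn_of_deriv_nonneg (convex_Icc v w) hcont.continuousOn
      (fun x _ => (hasDerivAt_profile β x).differentiableAt.differentiableWithinAt) (by
        intro x hx
        rw [interior_Icc] at hx
        rw [(hasDerivAt_profile β x).deriv]
        have := h1 x (hv.trans hx.1.le) hx.2.le
        exact div_nonneg (by linarith) (by positivity))
    exact hm (Set.left_mem_Icc.2 h) (Set.right_mem_Icc.2 h) h
  · have hm := antitoneOn_of_deriv_nonpos (convex_Icc w v) hcont.continuousOn
      (fun x _ => (hasDerivAt_profile β x).differentiableAt.differentiableWithinAt) (by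
        intro x hx
        rw [interior_Icc] at hx
        rw [(hasDerivAt_profile β x).deriv]
        have := h2 x hx.1.le
        exact div_nonpos_of_nonpos_of_nonneg (by linarith) (by positivity))
    exact hm (Set.left_mem_Icc.2 h) (Set.right_mem_Icc.2 h) h

/-- Monotonicity of `y ↦ artanh y / y` on `[0, 1)`. -/
lemma log_ratio_mul_le {y z : ℝ} (hy : 0 ≤ y) (hyz : y ≤ z) (hz : z < 1) :
    (Real.log (1 + y) - Real.log (1 - y)) * z ≤ (Real.log (1 + z) - Real.log (1 - z)) * y := by
  have h1 := Real.hasSum_log_sub_log_of_abs_lt_one (x := y) (by rw [abs_lt]; constructor <;> linarith)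
  have h2 := Real.hasSum_log_sub_log_of_abs_lt_one (x := z) (by rw [abs_lt]; constructor <;> linarith)
  refine hasSum_le (fun k => ?_) (h1.mul_right z) (h2.mul_right y)
  have : y ^ (2 * k) ≤ z ^ (2 * k) := by gcongr
  have hk : (0 : ℝ) ≤ 2 * (1 / (2 * k + 1)) * (y * z) :=
    mul_nonneg (by positivity) (mul_nonneg hy (hy.trans hyz))
  calc _ = 2 * (1 / (2 * k + 1)) * (y * z) * y ^ (2 * k) := by ring
    _ ≤ 2 * (1 / (2 * k + 1)) * (y * z) * z ^ (2 * k) := by gcongr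
    _ = _ := by ring

lemma two_mul_le_log_ratio {z : ℝ} (hz0 : 0 ≤ z) (hz : z < 1) :
    2 * z ≤ Real.log (1 + z) - Real.log (1 - z) := by
  have h2 := Real.hasSum_log_sub_log_of_abs_lt_one (x := z) (by rw [abs_lt]; constructor <;> linarith)
  have := h2.summable.sum_le_tsum {0} (fun k _ => by positivity)
  rw [h2.tsum_eq] at this
  simpa using this


lemma exists_logit {x : ℝ} (hx0 : 0 < x) (hx1 : x < 1) :
    ∃ v : ℝ, Real.sinh v / Real.cosh v = 2 * x - 1 ∧
      Real.log x = v - Real.log 2 - Real.log (Real.cosh v) ∧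
      Real.log (1 - x) = -v - Real.log 2 - Real.log (Real.cosh v) ∧
      x * (1 - x) = 1 / (4 * Real.cosh v ^ 2) := by
  have hx1' : 0 < 1 - x := by linarith
  set v := (Real.log x - Real.log (1 - x)) / 2 with hv
  have hc := Real.cosh_pos v
  have hE : Real.exp v * (1 - x) = Real.exp (-v) * x := by
    have h1 : Real.exp v * (1 - x) = Real.exp (v + Real.log (1 - x)) := by
      rw [Real.exp_add, Real.exp_log hx1']
    have h2 : Real.exp (-v) * x = Real.exp (-v + Real.log x) := by
      rw [Real.exp_add, Real.exp_log hx0]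
    rw [h1, h2, hv]
    congr 1
    ring
  have hxv : Real.exp v = x * (2 * Real.cosh v) := by
    rw [Real.cosh_eq]; linear_combination hE
  have hxv' : Real.exp (-v) = (1 - x) * (2 * Real.cosh v) := by
    rw [Real.cosh_eq]; linear_combination -hE
  refine ⟨v, ?_, ?_, ?_, ?_⟩
  · rw [div_eq_iff hc.ne', Real.sinh_eq, hxv, hxv']; ring
  · have := congrArg Real.log hxv
    rw [Real.log_exp, Real.log_mul hx0.ne' (by positivity), Real.log_mul two_ne_zero hc.ne'] at this
    linarith
  · have := congrArg Real.log hxv'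
    rw [Real.log_exp, Real.log_mul hx1'.ne' (by positivity), Real.log_mul two_ne_zero hc.ne'] at this
    linarith
  · have : Real.exp v * Real.exp (-v) = 1 := by rw [← Real.exp_add]; simp
    rw [hxv, hxv'] at this
    rw [eq_div_iff (by positivity)]
    linear_combination this

lemma one_div_sub_one_log {s : ℝ} (hs0 : 0 < s) (hs : s < 1 / 2) :
    Real.log (1 / s - 1) = Real.log (1 + (1 - 2 * s)) - Real.log (1 - (1 - 2 * s)) := by
  rw [← Real.log_div (by linarith) (by linarith)]
  congr 1
  have : (1 - (1 - 2 * s)) ≠ 0 := by linarith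
  field_simp
  ring

lemma log_one_div_sub_one_pos {s : ℝ} (hs0 : 0 < s) (hs : s < 1 / 2) :
    0 < Real.log (1 / s - 1) := by
  rw [one_div_sub_one_log hs0 hs]
  have := two_mul_le_log_ratio (z := 1 - 2 * s) (by linarith) (by linarith)
  linarith

/-- The logarithmic Sobolev inequality on a two-point space, when the larger mass is on the
first point. -/
lemma two_point_of_half_le {s θ a b : ℝ} (hs0 : 0 < s) (hs : s < 1 / 2) (h1 : 1 / 2 ≤ θ)
    (h2 : θ ≤ 1 - s) (ha : 0 < a) (hb : 0 < b) (hN : θ * a ^ 2 + (1 - θ) * b ^ 2 = 1) :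
    (1 - 2 * s) / Real.log (1 / s - 1) *
        (θ * (a ^ 2 * Real.log (a ^ 2)) + (1 - θ) * (b ^ 2 * Real.log (b ^ 2))) ≤
      1 - (θ * a + (1 - θ) * b) ^ 2 := by
  have hθ0 : 0 < θ := by linarith
  have hθ1 : 0 < 1 - θ := by linarith
  set x := θ * a ^ 2 with hx
  have hx0 : 0 < x := by positivity
  have hx1 : 1 - x = (1 - θ) * b ^ 2 := by linarith
  have hx1' : 0 < 1 - x := by rw [hx1]; positivity
  obtain ⟨w, hwt, hwl, hwl', hwp⟩ := exists_logit hθ0 (by linarith)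
  obtain ⟨v, hvt, hvl, hvl', hvp⟩ := exists_logit hx0 (by linarith)
  have hcw := Real.cosh_pos w
  have hcv := Real.cosh_pos v
  have hL := log_one_div_sub_one_pos hs0 hs
  have hw2 : 2 * w = Real.log (1 + (2 * θ - 1)) - Real.log (1 - (2 * θ - 1)) := by
    rw [show 1 + (2 * θ - 1) = 2 * θ by ring, show 1 - (2 * θ - 1) = 2 * (1 - θ) by ring,
      Real.log_mul two_ne_zero hθ0.ne', Real.log_mul two_ne_zero hθ1.ne', hwl, hwl']
    ring
  have hw0 : 0 ≤ w := by
    have := two_mul_le_log_ratio (z := 2 * θ - 1) (by linarith) (by linarith)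
    linarith
  have hsw : Real.sinh w = (2 * θ - 1) * Real.cosh w := by
    rw [← hwt]; field_simp
  obtain ⟨κ, hκ0, hκw, hκ1, hκs⟩ : ∃ κ : ℝ, 0 < κ ∧ κ * (2 * θ - 1) = w ∧
      (w = 0 → κ = 1) ∧ 2 * κ * (1 - 2 * s) ≤ Real.log (1 / s - 1) := by
    rcases eq_or_lt_of_le hw0 with h | h
    · have hy : 2 * θ - 1 = 0 := by
        rw [← hwt, ← h]; simp
      refine ⟨1, one_pos, by rw [hy, ← h]; ring, fun _ => rfl, ?_⟩
      rw [one_div_sub_one_log hs0 hs]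
      have := two_mul_le_log_ratio (z := 1 - 2 * s) (by linarith) (by linarith)
      linarith
    · have hy : 0 < 2 * θ - 1 := by
        rw [← hwt]; exact div_pos (Real.sinh_pos_iff.2 h) hcw
      refine ⟨w / (2 * θ - 1), div_pos h hy, by field_simp, fun h' => absurd h' h.ne', ?_⟩
      have := log_ratio_mul_le hy.le (show 2 * θ - 1 ≤ 1 - 2 * s by linarith) (by linarith)
      rw [← hw2, ← one_div_sub_one_log hs0 hs] at this
      rw [show 2 * (w / (2 * θ - 1)) * (1 - 2 * s) = 2 * w * (1 - 2 * s) / (2 * θ - 1) by ring,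
        div_le_iff₀ hy]
      exact this
  set β := κ / Real.cosh w with hβ
  have hβ0 : 0 < β := div_pos hκ0 hcw
  have hβw : β * Real.sinh w = w := by
    rw [hsw, hβ, ← hκw]; field_simp
  have hle : ∀ y, 0 ≤ y → y ≤ w → β * Real.sinh y ≤ y := by
    intro y hy hyw
    rcases eq_or_lt_of_le hw0 with h | h
    · have : y = 0 := by linarith
      simp [this]
    · have := mul_le_mul_of_nonneg_left (mul_sinh_le_mul_sinh hy hyw) hβ0.le
      have h3 : w * (β * Real.sinh y) ≤ w * y := by
        calc _ = β * (w * Real.sinh y) := by ring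
          _ ≤ β * (y * Real.sinh w) := this
          _ = y * (β * Real.sinh w) := by ring
          _ = w * y := by rw [hβw]; ring
      exact le_of_mul_le_mul_left h3 h
  have hge : ∀ y, w ≤ y → y ≤ β * Real.sinh y := by
    intro y hy
    rcases eq_or_lt_of_le hw0 with h | h
    · have : β = 1 := by rw [hβ, hκ1 h.symm, ← h]; simp
      rw [this, one_mul]
      exact Real.self_le_sinh_iff.2 (by linarith)
    · have := mul_le_mul_of_nonneg_left (mul_sinh_le_mul_sinh hw0 hy) hβ0.le
      have h3 : w * y ≤ w * (β * Real.sinh y) := by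
        calc w * y = y * (β * Real.sinh w) := by rw [hβw]; ring
          _ = β * (y * Real.sinh w) := by ring
          _ ≤ β * (w * Real.sinh y) := this
          _ = _ := by ring
      exact le_of_mul_le_mul_left h3 h
  have hprof : v * (2 * x - 1) - Real.log (Real.cosh v) + β / Real.cosh v ≤
      w * (2 * θ - 1) - Real.log (Real.cosh w) + β / Real.cosh w := by
    rw [← hvt, ← hwt]
    rcases le_total 0 v with h | h
    · exact profile_le h hle hge
    · have := profile_le (neg_nonneg.2 h) hle hge
      simpa [neg_div] using this
  have hκeq : w * (2 * θ - 1) + β / Real.cosh w = κ := by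
    have : 1 / Real.cosh w ^ 2 = 4 * (θ * (1 - θ)) := by rw [hwp]; field_simp
    calc _ = κ * (2 * θ - 1) * (2 * θ - 1) + κ * (1 / Real.cosh w ^ 2) := by
          rw [hκw, hβ]; field_simp
      _ = κ := by rw [this]; ring
  have hla : Real.log (a ^ 2) = Real.log x - Real.log θ := by
    rw [hx, Real.log_mul hθ0.ne' (by positivity)]; ring
  have hlb : Real.log (b ^ 2) = Real.log (1 - x) - Real.log (1 - θ) := by
    rw [hx1, Real.log_mul hθ1.ne' (by positivity)]; ring
  have hD : θ * (a ^ 2 * Real.log (a ^ 2)) + (1 - θ) * (b ^ 2 * Real.log (b ^ 2)) =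
      v * (2 * x - 1) - Real.log (Real.cosh v) - w * (2 * x - 1) + Real.log (Real.cosh w) := by
    rw [← mul_assoc, ← mul_assoc, ← hx, ← hx1, hla, hlb, hvl, hvl', hwl, hwl']
    ring
  have hab : θ * (1 - θ) * (a * b) = 1 / (4 * Real.cosh w * Real.cosh v) := by
    have hsq : (θ * (1 - θ) * (a * b)) ^ 2 = (1 / (4 * Real.cosh w * Real.cosh v)) ^ 2 := by
      calc _ = (θ * (1 - θ)) * ((θ * a ^ 2) * ((1 - θ) * b ^ 2)) := by ring
        _ = (θ * (1 - θ)) * (x * (1 - x)) := by rw [← hx, ← hx1]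
        _ = _ := by rw [hwp, hvp]; field_simp
    exact (pow_left_inj₀ (by positivity) (by positivity) two_ne_zero).1 hsq
  have hB : 2 * κ * (1 - (θ * a + (1 - θ) * b) ^ 2) =
      κ - w * (2 * x - 1) - β / Real.cosh v := by
    have h3 : (θ * a + (1 - θ) * b) ^ 2 =
        θ * x + (1 - θ) * (1 - x) + 2 * (1 / (4 * Real.cosh w * Real.cosh v)) := by
      rw [← hab, hx1, hx]; ring
    have h4 : κ - w * (2 * x - 1) = κ - κ * (2 * θ - 1) * (2 * x - 1) := by rw [hκw]
    rw [h3, h4, hβ]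
    field_simp
    ring
  have hDB : θ * (a ^ 2 * Real.log (a ^ 2)) + (1 - θ) * (b ^ 2 * Real.log (b ^ 2)) ≤
      2 * κ * (1 - (θ * a + (1 - θ) * b) ^ 2) := by
    rw [hD, hB]; linarith
  have hV : 0 ≤ 1 - (θ * a + (1 - θ) * b) ^ 2 := by
    have : 1 - (θ * a + (1 - θ) * b) ^ 2 = θ * (1 - θ) * (a - b) ^ 2 := by
      linear_combination hx - hN
    rw [this]; positivity
  rw [div_mul_eq_mul_div, div_le_iff₀ hL]
  calc _ ≤ (1 - 2 * s) * (2 * κ * (1 - (θ * a + (1 - θ) * b) ^ 2)) := by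
        apply mul_le_mul_of_nonneg_left hDB; linarith
    _ = (1 - (θ * a + (1 - θ) * b) ^ 2) * (2 * κ * (1 - 2 * s)) := by ring
    _ ≤ _ := mul_le_mul_of_nonneg_left hκs hV

/-- The logarithmic Sobolev inequality on a two-point space. -/
lemma two_point {s θ a b : ℝ} (hs0 : 0 < s) (hs : s < 1 / 2) (h1 : s ≤ θ)
    (h2 : θ ≤ 1 - s) (ha : 0 < a) (hb : 0 < b) (hN : θ * a ^ 2 + (1 - θ) * b ^ 2 = 1) :
    (1 - 2 * s) / Real.log (1 / s - 1) *
        (θ * (a ^ 2 * Real.log (a ^ 2)) + (1 - θ) * (b ^ 2 * Real.log (b ^ 2))) ≤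
      1 - (θ * a + (1 - θ) * b) ^ 2 := by
  rcases le_total (1 / 2) θ with h | h
  · exact two_point_of_half_le hs0 hs h h2 ha hb hN
  · have := two_point_of_half_le (θ := 1 - θ) hs0 hs (by linarith) (by linarith) hb ha (by linarith)
    rw [sub_sub_cancel] at this
    rwa [add_comm (θ * (a ^ 2 * _)), add_comm (θ * a)]


lemma hasDerivAt_sq_mul_log_sq (x : ℝ) :
    HasDerivAt (fun x : ℝ => x ^ 2 * Real.log (x ^ 2)) (2 * x * Real.log (x ^ 2) + 2 * x) x := by
  rcases eq_or_ne x 0 with rfl | hx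
  · rw [hasDerivAt_iff_tendsto_slope_zero]
    have h : Filter.Tendsto (fun t : ℝ => 2 * (t * Real.log t)) (nhdsWithin 0 {0}ᶜ) (nhds 0) := by
      have := (Real.continuous_mul_log.tendsto 0).const_mul 2
      simp only [zero_mul, mul_zero] at this
      exact this.mono_left nhdsWithin_le_nhds
    simp only [mul_zero, zero_mul, add_zero]
    refine h.congr' ?_
    filter_upwards [self_mem_nhdsWithin] with t ht
    have ht : t ≠ 0 := ht
    simp only [zero_add, smul_eq_mul, Real.log_pow]
    field_simp
    push_cast
    ring
  · have hx2 : x ^ 2 ≠ 0 := pow_ne_zero 2 hx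
    have h := (hasDerivAt_pow 2 x).mul ((hasDerivAt_pow 2 x).log hx2)
    refine h.congr_deriv ?_
    field_simp
    ring

lemma exp_eq_affine_of_lt {m A B x y z : ℝ} (hm : 0 < m) (hxy : x < y) (hyz : y < z)
    (hx : m * Real.exp x = A + B * x) (hy : m * Real.exp y = A + B * y)
    (hz : m * Real.exp z = A + B * z) : False := by
  have h := strictConvexOn_exp.slope_strict_mono_adjacent (Set.mem_univ x) (Set.mem_univ z) hxy hyz
  have h1 : m * ((Real.exp y - Real.exp x) / (y - x)) = B := by
    have : y - x ≠ 0 := by linarith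
    field_simp
    linear_combination hy - hx
  have h2 : m * ((Real.exp z - Real.exp y) / (z - y)) = B := by
    have : z - y ≠ 0 := by linarith
    field_simp
    linear_combination hz - hy
  have := mul_lt_mul_of_pos_left h hm
  linarith

/-- The graph of a multiple of `exp` meets a line at most twice. -/
lemma exp_eq_affine {m A B x y z : ℝ} (hm : 0 < m)
    (hx : m * Real.exp x = A + B * x) (hy : m * Real.exp y = A + B * y)
    (hz : m * Real.exp z = A + B * z) (hxy : x ≠ y) : z = x ∨ z = y := by
  by_contra! hne
  obtain ⟨hzx, hzy⟩ := hne
  rcases lt_or_gt_of_ne hxy with h1 | h1 <;> rcases lt_or_gt_of_ne hzx with h2 | h2 <;>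
    rcases lt_or_gt_of_ne hzy with h3 | h3 <;>
  first
    | exact exp_eq_affine_of_lt hm h1 h3 hx hy hz
    | exact exp_eq_affine_of_lt hm h2 h1 hz hx hy
    | exact exp_eq_affine_of_lt hm h2 h3 hx hz hy
    | exact exp_eq_affine_of_lt hm h1 h2 hy hx hz
    | exact exp_eq_affine_of_lt hm h3 h1 hz hy hx
    | exact exp_eq_affine_of_lt hm h3 h2 hy hz hx

section Classical

variable {n : Type*} [Fintype n]

/-- The difference between the variance of `f` and `α` times the entropy of `f ^ 2`,
for the measure on `n` with weights `q`. -/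
noncomputable def deficit (α : ℝ) (q f : n → ℝ) : ℝ :=
  ∑ i, q i * f i ^ 2 - (∑ i, q i * f i) ^ 2 -
    α * (∑ i, q i * (f i ^ 2 * Real.log (f i ^ 2)) -
      (∑ i, q i * f i ^ 2) * Real.log (∑ i, q i * f i ^ 2))

lemma deficit_smul (α : ℝ) (q f : n → ℝ) (hN : ∑ i, q i * f i ^ 2 ≠ 0) {r : ℝ} (hr : r ≠ 0) :
    deficit α q (fun i => r * f i) = r ^ 2 * deficit α q f := by
  have h1 : ∑ i, q i * (r * f i) ^ 2 = r ^ 2 * ∑ i, q i * f i ^ 2 := by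
    rw [Finset.mul_sum]; exact Finset.sum_congr rfl fun i _ => by ring
  have h2 : ∑ i, q i * (r * f i) = r * ∑ i, q i * f i := by
    rw [Finset.mul_sum]; exact Finset.sum_congr rfl fun i _ => by ring
  have h3 : ∑ i, q i * ((r * f i) ^ 2 * Real.log ((r * f i) ^ 2)) =
      r ^ 2 * (Real.log (r ^ 2) * (∑ i, q i * f i ^ 2) +
        ∑ i, q i * (f i ^ 2 * Real.log (f i ^ 2))) := by
    rw [Finset.mul_sum, ← Finset.sum_add_distrib, Finset.mul_sum]
    refine Finset.sum_congr rfl fun i _ => ?_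
    rcases eq_or_ne (f i) 0 with h | h
    · simp [h]
    · rw [mul_pow, Real.log_mul (pow_ne_zero 2 hr) (pow_ne_zero 2 h)]; ring
  unfold deficit
  rw [h1, h2, h3, Real.log_mul (pow_ne_zero 2 hr) hN]
  ring

lemma deficit_abs_le (α : ℝ) {q : n → ℝ} (hq : ∀ i, 0 ≤ q i) (f : n → ℝ) :
    deficit α q (fun i => |f i|) ≤ deficit α q f := by
  have : (∑ i, q i * f i) ^ 2 ≤ (∑ i, q i * |f i|) ^ 2 := by
    rw [sq_le_sq, abs_of_nonneg (Finset.sum_nonneg fun i _ => mul_nonneg (hq i) (abs_nonneg _))]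
    refine (Finset.abs_sum_le_sum_abs _ _).trans (Finset.sum_le_sum fun i _ => ?_)
    rw [abs_mul, abs_of_nonneg (hq i)]
  simp only [deficit, sq_abs]
  linarith

lemma continuous_deficit (α : ℝ) (q : n → ℝ) : Continuous (deficit α q) := by
  have h1 : Continuous fun f : n → ℝ => ∑ i, q i * f i ^ 2 := by fun_prop
  have h2 : Continuous fun f : n → ℝ => ∑ i, q i * (f i ^ 2 * Real.log (f i ^ 2)) :=
    continuous_finsetSum _ fun i _ =>
      continuous_const.mul (Real.continuous_mul_log.comp ((continuous_apply i).pow 2))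
  have h3 := Real.continuous_mul_log.comp h1
  have h4 : Continuous fun f : n → ℝ => (∑ i, q i * f i) ^ 2 := by fun_prop
  exact (h1.sub h4).sub (continuous_const.mul (h2.sub h3))

lemma exists_deficit_minimizer [Nonempty n] (α : ℝ) {q : n → ℝ} (hq : ∀ i, 0 < q i)
    (hsum : ∑ i, q i = 1) :
    ∃ f : n → ℝ, (∀ i, 0 ≤ f i) ∧ ∑ i, q i * f i ^ 2 = 1 ∧
      ∀ g : n → ℝ, deficit α q f * ∑ i, q i * g i ^ 2 ≤ deficit α q g := by
  let K : Set (n → ℝ) := {f | ∑ i, q i * f i ^ 2 = 1}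
  have hKc : IsClosed K := isClosed_eq (by fun_prop) continuous_const
  have hKb : K ⊆ Set.pi Set.univ fun i => Set.Icc (-(1 + 1 / q i)) (1 + 1 / q i) := by
    intro f hf i _
    have h1 : q i * f i ^ 2 ≤ 1 := by
      rw [← show ∑ i, q i * f i ^ 2 = 1 from hf]
      exact Finset.single_le_sum (f := fun i => q i * f i ^ 2)
        (fun j _ => mul_nonneg (hq j).le (sq_nonneg _)) (Finset.mem_univ i)
    have h2 : f i ^ 2 ≤ 1 / q i := by
      rw [le_div_iff₀ (hq i)]; linarith
    have h3 : 0 < 1 / q i := one_div_pos.2 (hq i)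
    exact abs_le.1 (abs_le_of_sq_le_sq (by nlinarith) (by linarith))
  have hK : IsCompact K :=
    (isCompact_univ_pi fun i => isCompact_Icc).of_isClosed_subset hKc hKb
  have hKn : K.Nonempty := ⟨fun _ => 1, by simp [K, hsum]⟩
  obtain ⟨f, hfK, hf⟩ := hK.exists_isMinOn hKn (continuous_deficit α q).continuousOn
  have hfN : ∑ i, q i * f i ^ 2 = 1 := hfK
  refine ⟨fun i => |f i|, fun i => abs_nonneg _, by simpa only [sq_abs] using hfN, fun g => ?_⟩
  have hN0 : 0 ≤ ∑ i, q i * g i ^ 2 :=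
    Finset.sum_nonneg fun i _ => mul_nonneg (hq i).le (sq_nonneg _)
  rcases eq_or_lt_of_le hN0 with h | h
  · have hg : g = 0 := by
      funext i
      have := (Finset.sum_eq_zero_iff_of_nonneg
        (fun i _ => mul_nonneg (hq i).le (sq_nonneg (g i)))).1 h.symm i (Finset.mem_univ i)
      simpa [(hq i).ne'] using this
    subst hg
    simp [deficit]
  · set r := (Real.sqrt (∑ i, q i * g i ^ 2))⁻¹ with hr
    have hr0 : r ≠ 0 := (inv_pos.2 (Real.sqrt_pos.2 h)).ne'
    have hr2 : r ^ 2 * ∑ i, q i * g i ^ 2 = 1 := by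
      rw [hr, inv_pow, Real.sq_sqrt h.le, inv_mul_cancel₀ h.ne']
    have hmem : (fun i => r * g i) ∈ K := by
      change ∑ i, q i * (r * g i) ^ 2 = 1
      rw [← hr2, Finset.mul_sum]
      exact Finset.sum_congr rfl fun i _ => by ring
    have h1 := (deficit_abs_le α (fun i => (hq i).le) f).trans (hf hmem)
    rw [deficit_smul α q g h.ne' hr0] at h1
    calc _ ≤ (r ^ 2 * deficit α q g) * ∑ i, q i * g i ^ 2 :=
          mul_le_mul_of_nonneg_right h1 h.le
      _ = (r ^ 2 * ∑ i, q i * g i ^ 2) * deficit α q g := by ring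
      _ = _ := by rw [hr2, one_mul]

lemma hasDerivAt_sum_update [DecidableEq n] (q f : n → ℝ) (i : n) {φ : ℝ → ℝ} {φ' : ℝ}
    (h : HasDerivAt φ φ' (f i)) :
    HasDerivAt (fun t => ∑ j, q j * φ (Function.update f i t j)) (q i * φ') (f i) := by
  have h1 : ∀ j ∈ Finset.univ, HasDerivAt (fun t => q j * φ (Function.update f i t j))
      (if j = i then q j * φ' else 0) (f i) := by
    intro j _
    by_cases hj : j = i
    · subst hj
      simpa using h.const_mul (q j)
    · simpa [hj] using hasDerivAt_const (f i) (q j * φ (f j))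
  simpa using HasDerivAt.fun_sum h1

/-- The Euler-Lagrange equation satisfied by a minimizer of the deficit. -/
lemma deficit_stationary (α : ℝ) {q f : n → ℝ} (hq : ∀ i, 0 < q i)
    (hN : ∑ i, q i * f i ^ 2 = 1)
    (hmin : ∀ g : n → ℝ, deficit α q f * ∑ i, q i * g i ^ 2 ≤ deficit α q g) (i : n) :
    f i - (∑ i, q i * f i) - α * (f i * Real.log (f i ^ 2)) = deficit α q f * f i := by
  classical
  have d1 := hasDerivAt_sum_update q f i (hasDerivAt_id (f i))
  have d2 := hasDerivAt_sum_update q f i (hasDerivAt_pow 2 (f i))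
  have d3 := hasDerivAt_sum_update q f i (hasDerivAt_sq_mul_log_sq (f i))
  simp only [id] at d1
  have hN' : ∑ j, q j * Function.update f i (f i) j ^ 2 = 1 := by
    rw [Function.update_eq_self]; exact hN
  have d4 := d2.mul (d2.log (by rw [hN']; exact one_ne_zero))
  have d := ((d2.sub (d1.pow 2)).sub ((d3.sub d4).const_mul α)).sub (d2.const_mul (deficit α q f))
  have hloc := IsLocalMin.hasDerivAt_eq_zero (Filter.Eventually.of_forall fun t => ?_) d
  · simp only [Function.update_eq_self, hN] at hloc
    have hqi := (hq i).ne'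
    apply mul_left_cancel₀ (mul_ne_zero two_ne_zero hqi)
    simp only [Real.log_one] at hloc
    norm_num [-Real.log_pow] at hloc
    linear_combination hloc
  · have h1 := hmin (Function.update f i t)
    have h0 : deficit α q f * ∑ j, q j * Function.update f i (f i) j ^ 2 =
        deficit α q (Function.update f i (f i)) := by
      rw [hN', Function.update_eq_self, mul_one]
    simp only [deficit] at h0 h1 ⊢
    simp only [Pi.sub_apply, Pi.mul_apply, Pi.pow_apply]
    linarith

lemma sum_eq_of_two_values [DecidableEq n] {q f : n → ℝ} (hsum : ∑ i, q i = 1) {a b : ℝ}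
    (hf : ∀ i, f i = a ∨ f i = b) (φ : ℝ → ℝ) :
    ∑ i, q i * φ (f i) = (∑ i with f i = a, q i) * φ a + (1 - ∑ i with f i = a, q i) * φ b := by
  rw [← Finset.sum_filter_add_sum_filter_not Finset.univ (fun i => f i = a)] at hsum ⊢
  rw [← hsum, add_sub_cancel_left, Finset.sum_mul, Finset.sum_mul]
  congr 1
  · exact Finset.sum_congr rfl fun i hi => by rw [(Finset.mem_filter.1 hi).2]
  · refine Finset.sum_congr rfl fun i hi => ?_
    rw [(hf i).resolve_left (Finset.mem_filter.1 hi).2]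

/-- The logarithmic Sobolev inequality for the simple classical generator. -/
lemma deficit_nonneg [Nonempty n] {s : ℝ} (hs0 : 0 < s) (hs : s < 1 / 2) {q : n → ℝ}
    (hq : ∀ i, s ≤ q i) (hsum : ∑ i, q i = 1) (g : n → ℝ) :
    0 ≤ deficit ((1 - 2 * s) / Real.log (1 / s - 1)) q g := by
  classical
  have hq0 : ∀ i, 0 < q i := fun i => hs0.trans_le (hq i)
  set α := (1 - 2 * s) / Real.log (1 / s - 1) with hα
  have hα0 : 0 < α := div_pos (by linarith) (log_one_div_sub_one_pos hs0 hs)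
  obtain ⟨f, hf0, hN, hmin⟩ := exists_deficit_minimizer α hq0 hsum
  have hst := deficit_stationary α hq0 hN hmin
  have hm0 : 0 ≤ ∑ i, q i * f i := Finset.sum_nonneg fun i _ => mul_nonneg (hq0 i).le (hf0 i)
  have hm : 0 < ∑ i, q i * f i := by
    refine lt_of_le_of_ne hm0 fun h => ?_
    have hz : ∀ i, f i = 0 := fun i => by
      have := (Finset.sum_eq_zero_iff_of_nonneg
        (fun i _ => mul_nonneg (hq0 i).le (hf0 i))).1 h.symm i (Finset.mem_univ i)
      simpa [(hq0 i).ne'] using this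
    simp [hz] at hN
  have hpos : ∀ i, 0 < f i := by
    refine fun i => lt_of_le_of_ne (hf0 i) fun h => ?_
    have := hst i
    rw [← h] at this
    simp only [zero_mul, mul_zero, sub_zero, zero_sub, neg_eq_zero] at this
    exact hm.ne' this
  suffices hc : 0 ≤ deficit α q f from
    le_trans (mul_nonneg hc
      (Finset.sum_nonneg fun i _ => mul_nonneg (hq0 i).le (sq_nonneg _))) (hmin g)
  have hexp : ∀ i, (∑ i, q i * f i) * Real.exp (-Real.log (f i)) =
      (1 - deficit α q f) + 2 * α * (-Real.log (f i)) := by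
    intro i
    have h1 := hst i
    have := (hpos i).ne'
    rw [Real.exp_neg, Real.exp_log (hpos i)]
    rw [Real.log_pow] at h1
    field_simp
    push_cast at h1
    linear_combination -h1
  obtain ⟨i₀⟩ := ‹Nonempty n›
  by_cases hall : ∀ i, f i = f i₀
  · have h1 : f i₀ = 1 := by
      simp only [hall, ← Finset.sum_mul, hsum, one_mul] at hN
      exact (pow_eq_one_iff_of_nonneg (hf0 i₀) two_ne_zero).1 hN
    simp [deficit, hall, h1, hsum]
  · push Not at hall
    obtain ⟨j₀, hj⟩ := hall
    have hval : ∀ i, f i = f i₀ ∨ f i = f j₀ := by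
      intro i
      have hne : -Real.log (f i₀) ≠ -Real.log (f j₀) := fun h =>
        hj (Real.log_injOn_pos (hpos j₀) (hpos i₀) (neg_injective h).symm)
      rcases exp_eq_affine hm (hexp i₀) (hexp j₀) (hexp i) hne with h | h
      · exact Or.inl (Real.log_injOn_pos (hpos i) (hpos i₀) (neg_injective h))
      · exact Or.inr (Real.log_injOn_pos (hpos i) (hpos j₀) (neg_injective h))
    have key := sum_eq_of_two_values (q := q) hsum hval
    set θ := ∑ i with f i = f i₀, q i with hθ
    have hθ1 : s ≤ θ := (hq i₀).trans
      (Finset.single_le_sum (f := q) (fun i _ => (hq0 i).le) (by simp))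
    have hθ2 : θ ≤ 1 - s := by
      have h1 : q j₀ ≤ ∑ i with ¬ f i = f i₀, q i :=
        Finset.single_le_sum (f := q) (fun i _ => (hq0 i).le) (by simpa using hj)
      have h2 := Finset.sum_filter_add_sum_filter_not Finset.univ (fun i => f i = f i₀) q
      have := hq j₀
      linarith
    have k1 := key (fun x => x)
    have k2 := key (fun x => x ^ 2)
    have k3 := key (fun x => x ^ 2 * Real.log (x ^ 2))
    have := two_point hs0 hs hθ1 hθ2 (hpos i₀) (hpos j₀) (by rw [← k2, hN])
    rw [← k1, ← k3, ← hα] at this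
    unfold deficit
    rw [hN, Real.log_one]
    linarith

end Classical

section Matrices

variable {n : Type*} [Fintype n] [DecidableEq n]

/-- The transition probabilities between two orthonormal bases. -/
noncomputable def overlap (U V : Matrix.unitaryGroup n ℂ) : Matrix n n ℝ :=
  Matrix.of fun i j => Complex.normSq ((star (U : Matrix n n ℂ) * (V : Matrix n n ℂ)) i j)

lemma sum_normSq_row (W : Matrix.unitaryGroup n ℂ) (i : n) :
    ∑ j, Complex.normSq ((W : Matrix n n ℂ) i j) = 1 := by
  have h := congrFun (congrFun (Matrix.mem_unitaryGroup_iff.1 W.2) i) i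
  rw [Matrix.mul_apply, Matrix.one_apply_eq] at h
  simp only [Matrix.star_apply, Complex.star_def, Complex.mul_conj] at h
  exact_mod_cast h

lemma overlap_mem_doublyStochastic (U V : Matrix.unitaryGroup n ℂ) :
    overlap U V ∈ doublyStochastic ℝ n := by
  rw [mem_doublyStochastic_iff_sum]
  refine ⟨fun i j => Complex.normSq_nonneg _, fun i => sum_normSq_row (star U * V) i, fun j => ?_⟩
  rw [← sum_normSq_row (star V * U) j]
  refine Finset.sum_congr rfl fun i _ => ?_
  rw [← Complex.normSq_conj]
  simp only [overlap, Matrix.of_apply]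
  have : ((star V * U : Matrix.unitaryGroup n ℂ) : Matrix n n ℂ) =
      star (star (U : Matrix n n ℂ) * (V : Matrix n n ℂ)) := by
    simp
  rw [this, Matrix.star_apply]
  simp

lemma overlap_self (U : Matrix.unitaryGroup n ℂ) : overlap U U = 1 := by
  ext i j
  have : star (U : Matrix n n ℂ) * (U : Matrix n n ℂ) = 1 := Matrix.mem_unitaryGroup_iff'.1 U.2
  rw [overlap, Matrix.of_apply, this, Matrix.one_apply, Matrix.one_apply]
  split <;> simp

/-- The Hermitian matrix with eigenvalues `d` and eigenvectors the columns of `U`. -/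
noncomputable def spectralMat (U : Matrix.unitaryGroup n ℂ) (d : n → ℝ) : Matrix n n ℂ :=
  (U : Matrix n n ℂ) * Matrix.diagonal (fun i => (d i : ℂ)) * star (U : Matrix n n ℂ)

lemma isHermitian_spectralMat (U : Matrix.unitaryGroup n ℂ) (d : n → ℝ) :
    (spectralMat U d).IsHermitian := by
  rw [Matrix.IsHermitian, ← Matrix.star_eq_conjTranspose, spectralMat, star_mul, star_mul,
    star_star, ← mul_assoc, Matrix.star_eq_conjTranspose (Matrix.diagonal _),
    Matrix.diagonal_conjTranspose]
  congr 3
  ext i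
  simp

lemma spectralMat_mul (U : Matrix.unitaryGroup n ℂ) (a b : n → ℝ) :
    spectralMat U a * spectralMat U b = spectralMat U (fun i => a i * b i) := by
  have h : star (U : Matrix n n ℂ) * (U : Matrix n n ℂ) = 1 := Matrix.mem_unitaryGroup_iff'.1 U.2
  calc _ = (U : Matrix n n ℂ) * Matrix.diagonal (fun i => (a i : ℂ)) *
        (star (U : Matrix n n ℂ) * (U : Matrix n n ℂ)) * Matrix.diagonal (fun i => (b i : ℂ)) *
        star (U : Matrix n n ℂ) := by simp only [spectralMat, mul_assoc]
    _ = _ := by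
      rw [h, mul_one, mul_assoc (U : Matrix n n ℂ), Matrix.diagonal_mul_diagonal, spectralMat]
      simp

lemma trace_spectralMat_mul (U V : Matrix.unitaryGroup n ℂ) (a b : n → ℝ) :
    (spectralMat U a * spectralMat V b).trace =
      ((∑ i, ∑ j, overlap U V i j * (a i * b j) : ℝ) : ℂ) := by
  set W := star (U : Matrix n n ℂ) * (V : Matrix n n ℂ) with hW
  have hW' : star W = star (V : Matrix n n ℂ) * (U : Matrix n n ℂ) := by simp [hW]
  have h1 : (spectralMat U a * spectralMat V b).trace =
      (Matrix.diagonal (fun i => (a i : ℂ)) * W * (Matrix.diagonal (fun i => (b i : ℂ)) *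
        star W)).trace := by
    rw [spectralMat, mul_assoc, mul_assoc, Matrix.trace_mul_comm, hW', hW]
    simp only [spectralMat, mul_assoc]
  rw [h1, Matrix.trace]
  push_cast
  refine Finset.sum_congr rfl fun i _ => ?_
  rw [Matrix.diag_apply, Matrix.mul_apply]
  refine Finset.sum_congr rfl fun j _ => ?_
  rw [Matrix.diagonal_mul, Matrix.diagonal_mul, Matrix.star_apply, overlap, Matrix.of_apply,
    ← hW, ← Complex.mul_conj]
  simp only [Complex.star_def]
  ring

lemma trace_spectralMat (U : Matrix.unitaryGroup n ℂ) (d : n → ℝ) :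
    (spectralMat U d).trace = ((∑ i, d i : ℝ) : ℂ) := by
  rw [spectralMat, Matrix.trace_mul_comm, ← mul_assoc, Matrix.mem_unitaryGroup_iff'.1 U.2, one_mul,
    Matrix.trace_diagonal]
  push_cast
  rfl

/-- The functional calculus does not depend on the choice of the diagonalization. -/
lemma matFun_spectralMat (U : Matrix.unitaryGroup n ℂ) (d : n → ℝ) (f : ℝ → ℝ) :
    matFun (spectralMat U d) f = spectralMat U (fun i => f (d i)) := by
  have hA := isHermitian_spectralMat U d
  rw [matFun, dif_pos hA]
  set V := hA.eigenvectorUnitary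
  set e := hA.eigenvalues
  have hVU : spectralMat V e = spectralMat U d := by
    have h := hA.spectral_theorem
    rw [Unitary.conjStarAlgAut_apply] at h
    exact h.symm
  have hU : star (U : Matrix n n ℂ) * (U : Matrix n n ℂ) = 1 := Matrix.mem_unitaryGroup_iff'.1 U.2
  have hU' : (U : Matrix n n ℂ) * star (U : Matrix n n ℂ) = 1 := Matrix.mem_unitaryGroup_iff.1 U.2
  have hV : star (V : Matrix n n ℂ) * (V : Matrix n n ℂ) = 1 := Matrix.mem_unitaryGroup_iff'.1 V.2
  have hV' : (V : Matrix n n ℂ) * star (V : Matrix n n ℂ) = 1 := Matrix.mem_unitaryGroup_iff.1 V.2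
  set W := star (V : Matrix n n ℂ) * (U : Matrix n n ℂ) with hW
  have hcomm : Matrix.diagonal (fun i => (e i : ℂ)) * W = W * Matrix.diagonal (fun i => (d i : ℂ)) := by
    calc _ = (star (V : Matrix n n ℂ) * (V : Matrix n n ℂ)) *
          Matrix.diagonal (fun i => (e i : ℂ)) * star (V : Matrix n n ℂ) * (U : Matrix n n ℂ) := by
          rw [hV, one_mul, mul_assoc]
      _ = star (V : Matrix n n ℂ) * spectralMat V e * (U : Matrix n n ℂ) := by
          simp only [spectralMat, mul_assoc]
      _ = W * Matrix.diagonal (fun i => (d i : ℂ)) * (star (U : Matrix n n ℂ) * U) := by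
          rw [hVU]; simp only [spectralMat, hW, mul_assoc]
      _ = _ := by rw [hU, mul_one]
  have hcomm' : Matrix.diagonal (fun i => (f (e i) : ℂ)) * W =
      W * Matrix.diagonal (fun i => (f (d i) : ℂ)) := by
    ext i j
    have h := congrFun (congrFun hcomm i) j
    rw [Matrix.diagonal_mul, Matrix.mul_diagonal] at h ⊢
    by_cases hw : W i j = 0
    · simp [hw]
    · have : e i = d j := by
        rw [mul_comm] at h
        exact_mod_cast mul_left_cancel₀ hw h
      rw [this, mul_comm]
  calc _ = (V : Matrix n n ℂ) * (Matrix.diagonal (fun i => (f (e i) : ℂ)) * W) *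
        star (U : Matrix n n ℂ) := by
        rw [hW]
        calc _ = (V : Matrix n n ℂ) * Matrix.diagonal (fun i => (f (e i) : ℂ)) *
              star (V : Matrix n n ℂ) * ((U : Matrix n n ℂ) * star (U : Matrix n n ℂ)) := by
              rw [hU', mul_one]
          _ = _ := by simp only [mul_assoc]
    _ = ((V : Matrix n n ℂ) * star (V : Matrix n n ℂ)) * (U : Matrix n n ℂ) *
        Matrix.diagonal (fun i => (f (d i) : ℂ)) * star (U : Matrix n n ℂ) := by
        rw [hcomm', hW]; simp only [mul_assoc]
    _ = _ := by rw [hV', one_mul]; rfl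

lemma mpow_spectralMat (U : Matrix.unitaryGroup n ℂ) (d : n → ℝ) (r : ℝ) :
    mpow (spectralMat U d) r = spectralMat U (fun i => d i ^ r) :=
  matFun_spectralMat U d _

lemma mlog_spectralMat (U : Matrix.unitaryGroup n ℂ) (d : n → ℝ) :
    mlog (spectralMat U d) = spectralMat U (fun i => Real.log (d i)) :=
  matFun_spectralMat U d _

lemma eq_spectralMat {A : Matrix n n ℂ} (hA : A.IsHermitian) :
    A = spectralMat hA.eigenvectorUnitary hA.eigenvalues := by
  have h := hA.spectral_theorem
  rwa [Unitary.conjStarAlgAut_apply] at h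

lemma posDef_spectralMat (U : Matrix.unitaryGroup n ℂ) {d : n → ℝ} (hd : ∀ i, 0 < d i) :
    (spectralMat U d).PosDef := by
  have h : (Matrix.diagonal fun i => (d i : ℂ)).PosDef :=
    Matrix.PosDef.diagonal fun i => by exact_mod_cast hd i
  have hU : IsUnit (U : Matrix n n ℂ) := (Unitary.toUnits U).isUnit
  exact (Matrix.IsUnit.posDef_star_right_conjugate_iff hU).2 h

lemma gammaPow_two_posSemidef {σ X : Matrix n n ℂ} {V : Matrix.unitaryGroup n ℂ} {q : n → ℝ}
    (hσ : σ = spectralMat V q) (hX : X.PosDef) : (gammaPow σ 2 X).PosSemidef := by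
  have h : (mpow σ (1 / (2 * 2))).IsHermitian := by
    rw [hσ, mpow_spectralMat]; exact isHermitian_spectralMat _ _
  have := hX.posSemidef.mul_mul_conjTranspose_same (mpow σ (1 / (2 * 2)))
  rw [h.eq] at this
  exact this

/-- The entropy in terms of the spectral data of `σ` and of `σ^{1/4} X σ^{1/4}`. -/
lemma ent_two_eq {σ X : Matrix n n ℂ} {U V : Matrix.unitaryGroup n ℂ} {q y : n → ℝ}
    (hσ : σ = spectralMat V q) (hY : gammaPow σ 2 X = spectralMat U y) :
    Ent σ 2 X = ∑ i, y i ^ 2 * Real.log (y i ^ 2) -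
      ∑ i, ∑ j, overlap U V i j * (y i ^ 2 * Real.log (q j)) -
      (∑ i, y i ^ 2) * Real.log (∑ i, y i ^ 2) := by
  have h2 : mpow (gammaPow σ 2 X) 2 = spectralMat U (fun i => y i ^ 2) := by
    rw [hY, mpow_spectralMat]; simp
  have hN0 : 0 ≤ ∑ i, y i ^ 2 := Finset.sum_nonneg fun i _ => sq_nonneg _
  have hw : wnorm σ 2 X ^ (2 : ℝ) = ∑ i, y i ^ 2 := by
    have h3 : mpow (mAbs (gammaPow σ 2 X)) 2 = spectralMat U (fun i => y i ^ 2) := by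
      rw [mAbs, hY, (isHermitian_spectralMat U y).eq, spectralMat_mul, mpow_spectralMat,
        mpow_spectralMat]
      congr 1
      funext i
      rw [← Real.rpow_mul (mul_self_nonneg _)]
      norm_num
      ring
    rw [wnorm, schatten, h3, trace_spectralMat, Complex.ofReal_re, ← Real.rpow_mul hN0]
    norm_num
  rw [Ent, hw, h2, mlog_spectralMat, spectralMat_mul, trace_spectralMat, hσ, mlog_spectralMat,
    trace_spectralMat_mul, Complex.ofReal_re, Complex.ofReal_re]

/-- The Dirichlet form in terms of the spectral data of `σ` and of `σ^{1/4} X σ^{1/4}`. -/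
lemma dirichlet_two_eq {σ X : Matrix n n ℂ} {U V : Matrix.unitaryGroup n ℂ} {q y : n → ℝ}
    (hq : ∀ i, 0 < q i) (hσ : σ = spectralMat V q) (hY : gammaPow σ 2 X = spectralMat U y) :
    ((mpow σ (1 / 2) * X * mpow σ (1 / 2) * (X - (σ * X).trace • 1)).trace).re =
      ∑ i, y i ^ 2 - (∑ i, ∑ j, overlap U V i j * (y i * Real.sqrt (q j))) ^ 2 := by
  set R := mpow σ (1 / (2 * 2)) with hR
  have hRR : mpow σ (1 / 2) = R * R := by
    rw [hR, hσ, mpow_spectralMat, mpow_spectralMat, spectralMat_mul]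
    congr 1
    funext i
    rw [← Real.rpow_add (hq i)]
    norm_num
  have hS : R * R = spectralMat V (fun i => Real.sqrt (q i)) := by
    rw [← hRR, hσ, mpow_spectralMat]
    congr 1
    funext i
    rw [Real.sqrt_eq_rpow]
  have hSS : σ = R * R * (R * R) := by
    rw [hS, spectralMat_mul]
    nth_rw 1 [hσ]
    congr 1
    funext i
    exact (Real.mul_self_sqrt (hq i).le).symm
  have hY' : R * X * R = spectralMat U y := hY
  have ht : (σ * X).trace =
      ((∑ i, ∑ j, overlap U V i j * (y i * Real.sqrt (q j)) : ℝ) : ℂ) := by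
    rw [← trace_spectralMat_mul, ← hS, ← hY', hSS]
    rw [show R * X * R * (R * R) = R * (X * R * (R * R)) by simp only [mul_assoc],
      show R * R * (R * R) * X = R * R * R * (R * X) by simp only [mul_assoc],
      Matrix.trace_mul_comm (R * R * R) (R * X)]
    simp only [mul_assoc]
  have ht' : (R * R * X * (R * R)).trace = (σ * X).trace := by
    rw [Matrix.trace_mul_comm, hSS]
    simp only [mul_assoc]
  have h2 : (R * R * X * (R * R) * X).trace = ((∑ i, y i ^ 2 : ℝ) : ℂ) := by
    have : R * R * X * (R * R) * X = R * (R * X * R * (R * X)) := by simp only [mul_assoc]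
    rw [this, Matrix.trace_mul_comm]
    have h3 : R * X * R * (R * X) * R = (R * X * R) * (R * X * R) := by simp only [mul_assoc]
    rw [h3, hY', spectralMat_mul, trace_spectralMat]
    simp only [pow_two]
  rw [hRR, mul_sub, Matrix.trace_sub, h2, Matrix.mul_smul, mul_one, Matrix.trace_smul, ht', ht,
    smul_eq_mul, ← Complex.ofReal_mul, ← Complex.ofReal_sub, Complex.ofReal_re, pow_two]

end Matrices

section Comparison

variable {n : Type*} [Fintype n]

lemma sum_permMatrix_mul [DecidableEq n] (π : Equiv.Perm n) (i : n) (a : n → ℝ) :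
    ∑ j, π.permMatrix ℝ i j * a j = a (π i) := by
  simp [Equiv.Perm.permMatrix, PEquiv.toMatrix_apply]

lemma log_sobolev_permutation [Nonempty n] {s : ℝ} (hs0 : 0 < s) (hs : s < 1 / 2) {q : n → ℝ}
    (hq : ∀ i, s ≤ q i) (hsum : ∑ i, q i = 1) (y : n → ℝ) (π : Equiv.Perm n) :
    (1 - 2 * s) / Real.log (1 / s - 1) *
        (∑ i, y i ^ 2 * Real.log (y i ^ 2) - ∑ i, y i ^ 2 * Real.log (q (π i)) -
          (∑ i, y i ^ 2) * Real.log (∑ i, y i ^ 2)) ≤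
      ∑ i, y i ^ 2 - (∑ i, y i * Real.sqrt (q (π i))) ^ 2 := by
  have hq0 : ∀ i, 0 < q i := fun i => hs0.trans_le (hq i)
  have h := deficit_nonneg hs0 hs (q := fun i => q (π i)) (fun i => hq _)
    ((Equiv.sum_comp π q).trans hsum) (fun i => y i / Real.sqrt (q (π i)))
  have h1 : ∀ i, q (π i) * (y i / Real.sqrt (q (π i))) ^ 2 = y i ^ 2 := fun i => by
    rw [div_pow, Real.sq_sqrt (hq0 _).le, mul_div_cancel₀ _ (hq0 _).ne']
  have h2 : ∀ i, q (π i) * (y i / Real.sqrt (q (π i))) = y i * Real.sqrt (q (π i)) := fun i => by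
    have := (Real.sqrt_pos.2 (hq0 (π i))).ne'
    field_simp
    rw [Real.sq_sqrt (hq0 _).le, mul_comm]
  have h3 : ∀ i, q (π i) * ((y i / Real.sqrt (q (π i))) ^ 2 *
      Real.log ((y i / Real.sqrt (q (π i))) ^ 2)) =
      y i ^ 2 * Real.log (y i ^ 2) - y i ^ 2 * Real.log (q (π i)) := fun i => by
    rw [← mul_assoc, h1]
    rcases eq_or_ne (y i) 0 with h0 | h0
    · simp [h0]
    · rw [div_pow, Real.sq_sqrt (hq0 _).le, Real.log_div (pow_ne_zero 2 h0) (hq0 _).ne']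
      ring
  simp only [deficit, h1, h2, h3, Finset.sum_sub_distrib] at h
  linarith

/-- By convexity and Birkhoff's theorem, the inequality for permutation matrices extends to all
doubly stochastic matrices. -/
lemma log_sobolev_doublyStochastic [DecidableEq n] [Nonempty n] {s : ℝ} (hs0 : 0 < s)
    (hs : s < 1 / 2) {q : n → ℝ} (hq : ∀ i, s ≤ q i) (hsum : ∑ i, q i = 1) (y : n → ℝ) {M : Matrix n n ℝ}
    (hM : M ∈ doublyStochastic ℝ n) :
    (1 - 2 * s) / Real.log (1 / s - 1) *
        (∑ i, y i ^ 2 * Real.log (y i ^ 2) - ∑ i, ∑ j, M i j * (y i ^ 2 * Real.log (q j)) -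
          (∑ i, y i ^ 2) * Real.log (∑ i, y i ^ 2)) ≤
      ∑ i, y i ^ 2 - (∑ i, ∑ j, M i j * (y i * Real.sqrt (q j))) ^ 2 := by
  set α := (1 - 2 * s) / Real.log (1 / s - 1) with hα
  let S : Set (Matrix n n ℝ) := {M | α * (∑ i, y i ^ 2 * Real.log (y i ^ 2) -
      ∑ i, ∑ j, M i j * (y i ^ 2 * Real.log (q j)) -
      (∑ i, y i ^ 2) * Real.log (∑ i, y i ^ 2)) ≤
    ∑ i, y i ^ 2 - (∑ i, ∑ j, M i j * (y i * Real.sqrt (q j))) ^ 2}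
  have hlin : ∀ (A B : Matrix n n ℝ) (a b : ℝ) (c : n → n → ℝ),
      ∑ i, ∑ j, (a • A + b • B) i j * c i j =
        a * ∑ i, ∑ j, A i j * c i j + b * ∑ i, ∑ j, B i j * c i j := by
    intro A B a b c
    simp only [Finset.mul_sum, ← Finset.sum_add_distrib]
    refine Finset.sum_congr rfl fun i _ => Finset.sum_congr rfl fun j _ => ?_
    simp only [Matrix.add_apply, Matrix.smul_apply, smul_eq_mul]
    ring
  have hconv : Convex ℝ S := by
    intro A hA B hB a b ha hb hab
    simp only [S, Set.mem_ofPred_eq] at hA hB ⊢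
    rw [hlin A B a b fun i j => y i ^ 2 * Real.log (q j),
      hlin A B a b fun i j => y i * Real.sqrt (q j)]
    generalize (∑ i, ∑ j, A i j * (y i * Real.sqrt (q j))) = u at *
    generalize (∑ i, ∑ j, B i j * (y i * Real.sqrt (q j))) = v at *
    obtain rfl : b = 1 - a := by linarith
    have h1 := mul_le_mul_of_nonneg_left hA ha
    have h2 := mul_le_mul_of_nonneg_left hB hb
    have h3 : 0 ≤ a * (1 - a) * (u - v) ^ 2 := mul_nonneg (mul_nonneg ha hb) (sq_nonneg _)
    linarith
  have hperm : {M | ∃ π : Equiv.Perm n, π.permMatrix ℝ = M} ⊆ S := by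
    rintro _ ⟨π, rfl⟩
    have h := log_sobolev_permutation hs0 hs hq hsum y π
    have h1 : ∀ i, ∑ j, π.permMatrix ℝ i j * (y i ^ 2 * Real.log (q j)) =
        y i ^ 2 * Real.log (q (π i)) :=
      fun i => sum_permMatrix_mul π i fun j => y i ^ 2 * Real.log (q j)
    have h2 : ∀ i, ∑ j, π.permMatrix ℝ i j * (y i * Real.sqrt (q j)) =
        y i * Real.sqrt (q (π i)) :=
      fun i => sum_permMatrix_mul π i fun j => y i * Real.sqrt (q j)
    simp only [S, Set.mem_ofPred_eq, h1, h2]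
    exact h
  have hM' : M ∈ convexHull ℝ {M | ∃ π : Equiv.Perm n, π.permMatrix ℝ = M} := by
    rw [← doublyStochastic_eq_convexHull_permMatrix]
    exact hM
  exact convexHull_min hperm hconv hM'

lemma entropy_nonneg [DecidableEq n] {q : n → ℝ} (hq : ∀ i, 0 < q i) (hsum : ∑ i, q i = 1)
    (y : n → ℝ) {M : Matrix n n ℝ} (hM : M ∈ doublyStochastic ℝ n) :
    0 ≤ ∑ i, y i ^ 2 * Real.log (y i ^ 2) - ∑ i, ∑ j, M i j * (y i ^ 2 * Real.log (q j)) -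
      (∑ i, y i ^ 2) * Real.log (∑ i, y i ^ 2) := by
  obtain ⟨hM0, hrow, hcol⟩ := mem_doublyStochastic_iff_sum.1 hM
  set N := ∑ i, y i ^ 2 with hN
  have hle : ∀ i, y i ^ 2 ≤ N := fun i =>
    Finset.single_le_sum (f := fun i => y i ^ 2) (fun j _ => sq_nonneg _) (Finset.mem_univ i)
  have hterm : ∀ i j, y i ^ 2 - N * q j ≤
      y i ^ 2 * Real.log (y i ^ 2) - y i ^ 2 * Real.log (q j) - y i ^ 2 * Real.log N := by
    intro i j
    rcases eq_or_lt_of_le (sq_nonneg (y i)) with h | h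
    · rw [← h]
      have := mul_nonneg ((sq_nonneg (y i)).trans (hle i)) (hq j).le
      simpa using this
    · have hN0 : 0 < N := h.trans_le (hle i)
      have h1 := Real.log_le_sub_one_of_pos (div_pos (mul_pos hN0 (hq j)) h)
      rw [Real.log_div (mul_pos hN0 (hq j)).ne' h.ne', Real.log_mul hN0.ne' (hq j).ne'] at h1
      have h2 := mul_le_mul_of_nonneg_left h1 h.le
      rw [mul_sub, mul_sub _ (_ / _), mul_div_cancel₀ _ h.ne'] at h2
      linarith
  have hsumrow : ∀ a : n → ℝ, ∑ i, ∑ j, M i j * a i = ∑ i, a i := fun a =>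
    Finset.sum_congr rfl fun i _ => by rw [← Finset.sum_mul, hrow, one_mul]
  have hsumcol : ∑ i, ∑ j, M i j * (N * q j) = N := by
    rw [Finset.sum_comm]
    simp only [← Finset.sum_mul, hcol, one_mul, ← Finset.mul_sum, hsum, mul_one]
  have h := Finset.sum_le_sum fun i (_ : i ∈ Finset.univ) => Finset.sum_le_sum
    fun j (_ : j ∈ Finset.univ) => mul_le_mul_of_nonneg_left (hterm i j) (hM0 i j)
  simp only [mul_sub, Finset.sum_sub_distrib] at h
  rw [hsumcol, hsumrow, hsumrow fun i => y i ^ 2 * Real.log (y i ^ 2),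
    hsumrow fun i => y i ^ 2 * Real.log N, ← Finset.sum_mul, ← hN] at h
  linarith

lemma sum_ite_eq_two_values [DecidableEq n] {q : n → ℝ} (hsum : ∑ i, q i = 1) (k : n) (a b : ℝ) :
    ∑ i, q i * (if i = k then a else b) = q k * a + (1 - q k) * b := by
  rw [← Finset.add_sum_erase _ _ (Finset.mem_univ k)] at hsum ⊢
  rw [if_pos rfl, ← hsum, add_sub_cancel_left, Finset.sum_mul]
  congr 1
  exact Finset.sum_congr rfl fun i hi => by rw [if_neg (Finset.ne_of_mem_erase hi)]

/-- The minimizer: a two-valued multiplier carrying the smallest eigenvalue `q k` of `σ` to the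
weight `1 - q k`. -/
lemma exists_two_valued_extremal [DecidableEq n] {q : n → ℝ} (hsum : ∑ i, q i = 1) {k : n}
    (hk0 : 0 < q k) (hk : q k < 1 / 2) :
    ∃ f : n → ℝ, (∀ i, 0 < f i) ∧ ∑ i, q i * f i ^ 2 = 1 ∧
      1 - (∑ i, q i * f i) ^ 2 = (1 - 2 * q k) ^ 2 ∧
      ∑ i, q i * (f i ^ 2 * Real.log (f i ^ 2)) = (1 - 2 * q k) * Real.log (1 / q k - 1) := by
  have hk1 : 0 < 1 - q k := by linarith
  set a := Real.sqrt ((1 - q k) / q k) with ha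
  set b := Real.sqrt (q k / (1 - q k)) with hb
  have ha0 : 0 < a := Real.sqrt_pos.2 (div_pos hk1 hk0)
  have hb0 : 0 < b := Real.sqrt_pos.2 (div_pos hk0 hk1)
  have ha2 : a ^ 2 = (1 - q k) / q k := Real.sq_sqrt (div_pos hk1 hk0).le
  have hb2 : b ^ 2 = q k / (1 - q k) := Real.sq_sqrt (div_pos hk0 hk1).le
  have hab : a * b = 1 := by
    rw [ha, hb, ← Real.sqrt_mul (div_pos hk1 hk0).le]
    field_simp
    simp
  have hval : ∀ φ : ℝ → ℝ, ∑ i, q i * φ (if i = k then a else b) =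
      q k * φ a + (1 - q k) * φ b := fun φ => by
    rw [← sum_ite_eq_two_values hsum k (φ a) (φ b)]
    simp only [apply_ite φ]
  refine ⟨fun i => if i = k then a else b, fun i => ?_, ?_, ?_, ?_⟩
  · dsimp only
    split_ifs <;> assumption
  · rw [hval fun x => x ^ 2, ha2, hb2]
    field_simp
    ring
  · rw [hval fun x => x]
    have h1 : (q k * a + (1 - q k) * b) ^ 2 = q k * (q k * a ^ 2) +
        (1 - q k) * ((1 - q k) * b ^ 2) + 2 * q k * (1 - q k) * (a * b) := by ring
    rw [h1, ha2, hb2, hab, mul_div_cancel₀ _ hk0.ne', mul_div_cancel₀ _ hk1.ne']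
    ring
  · rw [hval fun x => x ^ 2 * Real.log (x ^ 2), ha2, hb2]
    have h1 : (1 - q k) / q k = 1 / q k - 1 := by field_simp
    have h2 : Real.log (q k / (1 - q k)) = -Real.log (1 / q k - 1) := by
      rw [← h1, ← Real.log_inv, inv_div]
    rw [h2, ← h1]
    field_simp
    ring

end Comparison
end LogSobolev

/-- The 2-log-Sobolev constant of the simple Lindblad generator
`L(X) = X - tr(σX)·I` equals `(1 - 2 s_min(σ)) / log(1/s_min(σ) - 1)`. -/
theorem two_log_sobolev_simple {n : Type*} [Fintype n] [DecidableEq n] [Nonempty n]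
    (hcard : 2 ≤ Fintype.card n)
    (σ : Matrix n n ℂ) (hσ : σ.PosDef) (hσ1 : σ.trace = 1)
    (s : ℝ) (hs : s = ⨅ i, hσ.1.eigenvalues i) (hs2 : s < 1/2) :
    sInf {r : ℝ | ∃ X : Matrix n n ℂ, X.PosDef ∧ Ent σ 2 X ≠ 0 ∧
        r = ((mpow σ (1/2) * X * mpow σ (1/2) *
          (X - (σ * X).trace • 1)).trace).re / Ent σ 2 X} =
      (1 - 2 * s) / Real.log (1 / s - 1) := by
  classical
  set q := hσ.1.eigenvalues with hq
  set V := hσ.1.eigenvectorUnitary with hV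
  have hσV : σ = LogSobolev.spectralMat V q := LogSobolev.eq_spectralMat hσ.1
  have hq0 : ∀ i, 0 < q i := hσ.eigenvalues_pos
  have hsum : ∑ i, q i = 1 := by
    rw [hσV, LogSobolev.trace_spectralMat] at hσ1
    exact_mod_cast hσ1
  have hsq : ∀ i, s ≤ q i := fun i => hs ▸ ciInf_le (Set.finite_range q).bddBelow i
  obtain ⟨k, hk⟩ := exists_eq_ciInf_of_finite (f := q)
  have hks : q k = s := hk.trans hs.symm
  have hs0 : 0 < s := hks ▸ hq0 k
  have hL := LogSobolev.log_one_div_sub_one_pos hs0 hs2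
  apply IsLeast.csInf_eq
  constructor
  · obtain ⟨f, hf0, hf1, hf2, hf3⟩ :=
      LogSobolev.exists_two_valued_extremal hsum (hq0 k) (hks ▸ hs2)
    rw [hks] at hf2 hf3
    have hY : gammaPow σ 2 (LogSobolev.spectralMat V f) =
        LogSobolev.spectralMat V (fun i => Real.sqrt (q i) * f i) := by
      rw [gammaPow, hσV, LogSobolev.mpow_spectralMat, LogSobolev.spectralMat_mul,
        LogSobolev.spectralMat_mul]
      congr 1
      funext i
      rw [mul_right_comm, ← Real.rpow_add (hq0 i), Real.sqrt_eq_rpow]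
      norm_num
    have hsq2 : ∀ i, (Real.sqrt (q i) * f i) ^ 2 = q i * f i ^ 2 := fun i => by
      rw [mul_pow, Real.sq_sqrt (hq0 i).le]
    have hent : Ent σ 2 (LogSobolev.spectralMat V f) = (1 - 2 * s) * Real.log (1 / s - 1) := by
      rw [LogSobolev.ent_two_eq hσV hY, LogSobolev.overlap_self, ← hf3]
      simp only [hsq2, hf1, Real.log_one, mul_zero, sub_zero, Matrix.one_apply, ite_mul, one_mul,
        zero_mul, Finset.sum_ite_eq, Finset.mem_univ, if_true]
      rw [← Finset.sum_sub_distrib]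
      refine Finset.sum_congr rfl fun i _ => ?_
      rw [Real.log_mul (hq0 i).ne' (pow_pos (hf0 i) 2).ne']
      ring
    have hdir := LogSobolev.dirichlet_two_eq hq0 hσV hY
    rw [LogSobolev.overlap_self] at hdir
    have hone : ∀ i, Real.sqrt (q i) * f i * Real.sqrt (q i) = q i * f i := fun i => by
      rw [mul_right_comm, Real.mul_self_sqrt (hq0 i).le]
    simp only [hsq2, hf1, Matrix.one_apply, ite_mul, one_mul,
      zero_mul, Finset.sum_ite_eq, Finset.mem_univ, if_true, hone, hf2] at hdir
    have h2s : 1 - 2 * s ≠ 0 := by linarith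
    refine ⟨LogSobolev.spectralMat V f, LogSobolev.posDef_spectralMat V hf0, ?_, ?_⟩
    · rw [hent]
      exact mul_ne_zero h2s hL.ne'
    · rw [hdir, hent, pow_two, mul_div_mul_left _ _ h2s]
  · rintro r ⟨X, hX, hne, rfl⟩
    have hYpos := LogSobolev.gammaPow_two_posSemidef hσV hX
    have hY := LogSobolev.eq_spectralMat hYpos.1
    have hw := LogSobolev.overlap_mem_doublyStochastic hYpos.1.eigenvectorUnitary V
    have hent := LogSobolev.ent_two_eq hσV hY
    have hent0 : 0 < Ent σ 2 X := by
      refine lt_of_le_of_ne ?_ hne.symm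
      rw [hent]
      exact LogSobolev.entropy_nonneg hq0 hsum _ hw
    rw [le_div_iff₀ hent0, LogSobolev.dirichlet_two_eq hq0 hσV hY, hent]
    exact LogSobolev.log_sobolev_doublyStochastic hs0 hs2 hsq hsum _ hw
end
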